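/- arXiv:math/0502226 — 4 statements merged into one kernel-verified Lean document; each statement's English description precedes it below -/
import Mathlib

section
/- The map d_GHwt defined by d_GHwt(X,Y) := inf{Σ_{i=1}^{n−1} Δ_GHwt(Z_i, Z_{i+1})^{1/4}}, the infimum being over all finite sequences of weighted compact real trees Z₁,…,Z_n with Z₁ = X and Z_n = Y, is a metric on T^wt, the set of weight-preserving isometry classes of weighted compact real trees. Moreover, (1/2)·Δ_GHwt(X,Y)^{1/4} ≤ d_GHwt(X,Y) ≤ Δ_GHwt(X,Y)^{1/4} for all X, Y ∈ T^wt. -/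
open Metric Set

/-- The four point condition for a distance function. -/
def FourPoint {X : Type*} (d : X → X → ℝ) : Prop :=
  ∀ x₁ x₂ x₃ x₄ : X, d x₁ x₂ + d x₃ x₄ ≤ max (d x₁ x₃ + d x₂ x₄) (d x₁ x₄ + d x₂ x₃)

/-- A real tree: a metric space which is complete, path-connected and satisfies
the four point condition. -/
def IsRealTree (X : Type*) [MetricSpace X] : Prop :=
  CompleteSpace X ∧ PathConnectedSpace X ∧ FourPoint (fun x y : X => dist x y)

/-- `dis(f) ≤ ε`: the distortion of `f` is at most `ε`. -/
def DistortionLE {X Y : Type*} [MetricSpace X] [MetricSpace Y] (f : X → Y) (ε : ℝ) : Prop :=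
  ∀ x₁ x₂ : X, |dist x₁ x₂ - dist (f x₁) (f x₂)| ≤ ε

/-- `f` is an `ε`-isometry: it has distortion at most `ε` and its range is an `ε`-net. -/
def IsEpsIsometry {X Y : Type*} [MetricSpace X] [MetricSpace Y] (f : X → Y) (ε : ℝ) : Prop :=
  DistortionLE f ε ∧ ∀ y : Y, ∃ x : X, dist y (f x) ≤ ε

/-- The Prohorov distance between two Borel measures. -/
noncomputable def prohorovDist {X : Type*} [MetricSpace X] [MeasurableSpace X]
    (μ ν : MeasureTheory.Measure X) : ℝ :=
  sInf {ε : ℝ | 0 < ε ∧ ∀ C : Set X, IsClosed C →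
    μ C ≤ ν (Metric.thickening ε C) + ENNReal.ofReal ε}

/-- `Δ_GHwt` between two weighted metric spaces: the infimum of all `ε > 0` such that there
exist Borel measurable `ε`-isometries `f : X → Y` and `g : Y → X` with
`d_P(f_*ν_X, ν_Y) ≤ ε` and `d_P(ν_X, g_*ν_Y) ≤ ε`. -/
noncomputable def DeltaGHwt (X Y : Type*) [MetricSpace X] [MeasurableSpace X]
    [MetricSpace Y] [MeasurableSpace Y]
    (νX : MeasureTheory.Measure X) (νY : MeasureTheory.Measure Y) : ℝ :=
  sInf {ε : ℝ | 0 < ε ∧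
    (∃ f : X → Y, Measurable f ∧ IsEpsIsometry f ε ∧ prohorovDist (νX.map f) νY ≤ ε) ∧
    (∃ g : Y → X, Measurable g ∧ IsEpsIsometry g ε ∧ prohorovDist νX (νY.map g) ≤ ε)}

/-- A weighted compact real tree: a compact real tree together with a Borel
probability measure on it. -/
structure WtRealTree : Type 1 where
  carrier : Type
  [met : MetricSpace carrier]
  [cpt : CompactSpace carrier]
  [nem : Nonempty carrier]
  tree : IsRealTree carrier
  ν : @MeasureTheory.Measure carrier (borel carrier)
  prob : @MeasureTheory.IsProbabilityMeasure carrier (borel carrier) ν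

attribute [instance] WtRealTree.met WtRealTree.cpt WtRealTree.nem

/-- `Δ_GHwt` between two weighted compact real trees. -/
noncomputable def WtRealTree.Delta (X Y : WtRealTree) : ℝ :=
  letI : MeasurableSpace X.carrier := borel X.carrier
  letI : MeasurableSpace Y.carrier := borel Y.carrier
  DeltaGHwt X.carrier Y.carrier X.ν Y.ν

/-- Two weighted compact real trees are weight-preserving isometric if there
is a surjective isometry between them pushing one weight to the other. -/
def WtRealTree.WPIsometric (X Y : WtRealTree) : Prop :=
  ∃ φ : X.carrier → Y.carrier, Isometry φ ∧ Function.Surjective φ ∧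
    @MeasureTheory.Measure.map _ _ (borel X.carrier) (borel Y.carrier) φ X.ν = Y.ν

/-- The weighted Gromov–Hausdorff distance: the infimum of
`Σ_{i=1}^{n-1} Δ_GHwt(Z_i, Z_{i+1})^{1/4}` over all finite chains of weighted compact real
trees `Z₁ = X, …, Z_n = Y`. -/
noncomputable def dGHwt (X Y : WtRealTree) : ℝ :=
  sInf {r : ℝ | ∃ (n : ℕ) (Z : Fin (n + 1) → WtRealTree), Z 0 = X ∧ Z (Fin.last n) = Y ∧
    r = ∑ i : Fin n, (WtRealTree.Delta (Z i.castSucc) (Z i.succ)) ^ ((1 : ℝ) / 4)}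

open MeasureTheory Filter Topology

namespace GHAux

set_option linter.unusedSectionVars false
set_option linter.style.haveILetI false

/-- The Prohorov condition at level `ε`. -/
def PP {X : Type*} [MetricSpace X] [MeasurableSpace X] (ε : ℝ) (μ ν : Measure X) : Prop :=
  0 < ε ∧ ∀ C : Set X, IsClosed C → μ C ≤ ν (Metric.thickening ε C) + ENNReal.ofReal ε

section prohorov
variable {X Y : Type*} [MetricSpace X] [MeasurableSpace X] [BorelSpace X]
  [MetricSpace Y] [MeasurableSpace Y] [BorelSpace Y]

lemma PP.mono {ε δ : ℝ} {μ ν : Measure X} (h : PP ε μ ν) (hd : ε ≤ δ) : PP δ μ ν := by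
  refine ⟨h.1.trans_le hd, fun C hC => (h.2 C hC).trans ?_⟩
  gcongr

lemma PP.one (μ ν : Measure X) [IsProbabilityMeasure μ] : PP 1 μ ν := by
  refine ⟨one_pos, fun C _ => ?_⟩
  simpa using le_add_left (prob_le_one (μ := μ) (s := C))

lemma PP.refl {ε : ℝ} (hε : 0 < ε) (μ : Measure X) : PP ε μ μ := by
  refine ⟨hε, fun C _ => le_add_right (measure_mono (self_subset_thickening hε C))⟩

lemma PP.symm {ε : ℝ} {μ ν : Measure X} [IsProbabilityMeasure μ] [IsProbabilityMeasure ν]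
    (h : PP ε μ ν) : PP ε ν μ := by
  refine ⟨h.1, fun C hC => ?_⟩
  have hD := h.2 (thickening ε C)ᶜ isOpen_thickening.isClosed_compl
  have hsub : thickening ε (thickening ε C)ᶜ ⊆ Cᶜ := by
    intro x hx hxC
    obtain ⟨y, hy, hxy⟩ := mem_thickening_iff.1 hx
    exact hy (mem_thickening_iff.2 ⟨x, hxC, by rwa [dist_comm]⟩)
  have h1 : μ (thickening ε C)ᶜ ≤ ν Cᶜ + ENNReal.ofReal ε :=
    hD.trans (by gcongr)
  have e1 : μ (thickening ε C) + μ (thickening ε C)ᶜ = 1 := by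
    rw [measure_add_measure_compl isOpen_thickening.measurableSet, measure_univ]
  have e2 : ν C + ν Cᶜ = 1 := by
    rw [measure_add_measure_compl hC.measurableSet, measure_univ]
  have hfin : ν Cᶜ ≠ ⊤ := measure_ne_top _ _
  have : ν C + ν Cᶜ ≤ (μ (thickening ε C) + ENNReal.ofReal ε) + ν Cᶜ := by
    rw [e2, ← e1, add_assoc]
    gcongr
    rwa [add_comm]
  exact (ENNReal.add_le_add_iff_right hfin).1 this

lemma PP.trans {a b : ℝ} {μ ν ρ : Measure X} (h : PP a μ ν) (h' : PP b ν ρ) :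
    PP (a + b) μ ρ := by
  refine ⟨add_pos h.1 h'.1, fun C hC => ?_⟩
  calc μ C ≤ ν (thickening a C) + ENNReal.ofReal a := h.2 C hC
    _ ≤ ν (closure (thickening a C)) + ENNReal.ofReal a := by gcongr; exact subset_closure
    _ ≤ (ρ (thickening b (closure (thickening a C))) + ENNReal.ofReal b) + ENNReal.ofReal a := by
        gcongr; exact h'.2 _ isClosed_closure
    _ ≤ ρ (thickening (a + b) C) + ENNReal.ofReal (a + b) := by
        rw [thickening_closure, ENNReal.ofReal_add h.1.le h'.1.le, add_assoc,
          add_comm (ENNReal.ofReal b)]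
        gcongr
        rw [add_comm a b]
        exact thickening_thickening_subset _ _ _

lemma PP.map {a e : ℝ} {μ ν : Measure X} (h : PP a μ ν) {g : X → Y} (hg : Measurable g)
    (he : 0 ≤ e) (hd : DistortionLE g e) : PP (a + e) (μ.map g) (ν.map g) := by
  refine ⟨by linarith [h.1], fun C hC => ?_⟩
  rw [Measure.map_apply hg hC.measurableSet,
    Measure.map_apply hg isOpen_thickening.measurableSet]
  calc μ (g ⁻¹' C) ≤ μ (closure (g ⁻¹' C)) := measure_mono subset_closure
    _ ≤ ν (thickening a (closure (g ⁻¹' C))) + ENNReal.ofReal a := h.2 _ isClosed_closure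
    _ ≤ _ := by
        rw [thickening_closure]
        gcongr
        · intro x hx
          obtain ⟨y, hy, hxy⟩ := mem_thickening_iff.1 hx
          refine mem_thickening_iff.2 ⟨g y, hy, ?_⟩
          have := (abs_le.1 (hd x y)).1
          linarith
        · linarith

/-- Perturbing the map. -/
lemma PP.map_close {e : ℝ} {μ : Measure X} {f g : X → Y} (hf : Measurable f)
    (hg : Measurable g) (he : 0 < e) (h : ∀ x, dist (f x) (g x) < e) :
    PP e (μ.map f) (μ.map g) := by
  refine ⟨he, fun C hC => ?_⟩
  rw [Measure.map_apply hf hC.measurableSet,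
    Measure.map_apply hg isOpen_thickening.measurableSet]
  refine le_add_right (measure_mono fun x hx => mem_thickening_iff.2 ⟨f x, hx, ?_⟩)
  rw [dist_comm]; exact h x

lemma PP.le {μ ν : Measure X} [IsProbabilityMeasure μ] [IsProbabilityMeasure ν]
    (h : ∀ ε > 0, PP ε μ ν) {C : Set X} (hC : IsClosed C) : μ C ≤ ν C := by
  have h1 : Tendsto (fun r => ν (thickening r C)) (𝓝[>] 0) (𝓝 (ν C)) :=
    tendsto_measure_thickening_of_isClosed ⟨1, one_pos, measure_ne_top _ _⟩ hC
  have h2 : Tendsto (fun r : ℝ => ENNReal.ofReal r) (𝓝[>] 0) (𝓝 0) := by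
    have := (ENNReal.continuous_ofReal.tendsto 0)
    rw [ENNReal.ofReal_zero] at this
    exact this.mono_left nhdsWithin_le_nhds
  have h3 := h1.add h2
  rw [add_zero] at h3
  refine ge_of_tendsto h3 ?_
  filter_upwards [self_mem_nhdsWithin] with r hr
  exact (h r hr).2 C hC

lemma PP.eq {μ ν : Measure X} [IsProbabilityMeasure μ] [IsProbabilityMeasure ν]
    (h : ∀ ε > 0, PP ε μ ν) : μ = ν := by
  refine ext_of_generate_finite {s | IsClosed s} ?_ isPiSystem_isClosed
    (fun C hC => le_antisymm (PP.le h hC) (PP.le (fun ε hε => (h ε hε).symm) hC)) (by simp)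
  rw [BorelSpace.measurable_eq (α := X), borel_eq_generateFrom_isClosed]

lemma PP.dist_le {ε : ℝ} {μ ν : Measure X} (h : PP ε μ ν) : prohorovDist μ ν ≤ ε :=
  csInf_le ⟨0, fun _ hx => hx.1.le⟩ h

lemma PP.of_dist_lt {ε : ℝ} {μ ν : Measure X} [IsProbabilityMeasure μ]
    (h : prohorovDist μ ν < ε) : PP ε μ ν := by
  obtain ⟨δ, hδ, hlt⟩ := exists_lt_of_csInf_lt ⟨1, PP.one μ ν⟩ h
  exact PP.mono hδ hlt.le

end prohorov

section half
variable {X Y Z : Type*} [MetricSpace X] [MeasurableSpace X] [BorelSpace X]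
  [MetricSpace Y] [MeasurableSpace Y] [BorelSpace Y]
  [MetricSpace Z] [MeasurableSpace Z] [BorelSpace Z]

/-- One-sided approximation at level `ε`. -/
def Half (μ : Measure X) (ν : Measure Y) (ε : ℝ) : Prop :=
  ∃ f : X → Y, Measurable f ∧ IsEpsIsometry f ε ∧ PP ε (μ.map f) ν

lemma Half.comp {μ : Measure X} {ν : Measure Y} {ρ : Measure Z} {a b : ℝ}
    (h : Half μ ν a) (h' : Half ν ρ b) : Half μ ρ (2 * (a + b)) := by
  obtain ⟨f, hf, ⟨fd, fn⟩, fp⟩ := h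
  obtain ⟨g, hg, ⟨gd, gn⟩, gp⟩ := h'
  have ha := fp.1
  have hb := gp.1
  refine ⟨g ∘ f, hg.comp hf, ⟨fun x y => ?_, fun z => ?_⟩, ?_⟩
  · have h1 := abs_le.1 (fd x y)
    have h2 := abs_le.1 (gd (f x) (f y))
    rw [abs_le]
    simp only [Function.comp_apply]
    constructor <;> linarith [h1.1, h1.2, h2.1, h2.2]
  · obtain ⟨y, hy⟩ := gn z
    obtain ⟨x, hx⟩ := fn y
    refine ⟨x, ?_⟩
    have h2 := (abs_le.1 (gd y (f x))).1
    have := dist_triangle z (g y) (g (f x))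
    simp only [Function.comp_apply]
    linarith
  · rw [← Measure.map_map hg hf]
    exact ((fp.map hg hb.le gd).trans gp).mono (by linarith)

lemma Half.const [CompactSpace X] [CompactSpace Y] [Nonempty X] [Nonempty Y] (μ : Measure X)
    (ν : Measure Y) [IsProbabilityMeasure μ] :
    Half μ ν (1 + diam (univ : Set X) + diam (univ : Set Y)) := by
  obtain ⟨y₀⟩ := ‹Nonempty Y›
  obtain ⟨x₀⟩ := ‹Nonempty X›
  have hX : 0 ≤ diam (univ : Set X) := diam_nonneg
  have hY : 0 ≤ diam (univ : Set Y) := diam_nonneg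
  refine ⟨fun _ => y₀, measurable_const, ⟨fun x y => ?_, fun y => ⟨x₀, ?_⟩⟩, ?_⟩
  · have := dist_le_diam_of_mem isCompact_univ.isBounded (mem_univ x) (mem_univ y)
    rw [dist_self, sub_zero, abs_of_nonneg dist_nonneg]
    linarith
  · have := dist_le_diam_of_mem isCompact_univ.isBounded (mem_univ y) (mem_univ y₀)
    linarith
  · haveI : IsProbabilityMeasure (μ.map fun _ => y₀) :=
      Measure.isProbabilityMeasure_map measurable_const.aemeasurable
    exact (PP.one _ _).mono (by linarith)

lemma Half.of_isometry {μ : Measure X} {ν : Measure Y} {φ : X → Y} (hφ : Isometry φ)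
    (hs : Function.Surjective φ) (hm : μ.map φ = ν) {ε : ℝ} (hε : 0 < ε) : Half μ ν ε := by
  refine ⟨φ, hφ.continuous.measurable, ⟨fun x y => ?_, fun y => ?_⟩, ?_⟩
  · simp [hφ.dist_eq, hε.le]
  · obtain ⟨x, rfl⟩ := hs y
    exact ⟨x, by simp [hε.le]⟩
  · rw [hm]; exact PP.refl hε _

lemma Half.mono {μ : Measure X} {ν : Measure Y} {ε δ : ℝ} (h : Half μ ν ε) (hd : ε ≤ δ) :
    Half μ ν δ := by
  obtain ⟨f, hf, ⟨fd, fn⟩, fp⟩ := h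
  exact ⟨f, hf, ⟨fun x y => (fd x y).trans hd, fun y => (fn y).imp fun x hx => hx.trans hd⟩,
    fp.mono hd⟩

lemma Delta_le {μ : Measure X} {ν : Measure Y} [IsProbabilityMeasure μ]
    [IsProbabilityMeasure ν] {ε : ℝ} (h : Half μ ν ε) (h' : Half ν μ ε) :
    DeltaGHwt X Y μ ν ≤ ε := by
  obtain ⟨f, hf, fi, fp⟩ := h
  obtain ⟨g, hg, gi, gp⟩ := h'
  haveI : IsProbabilityMeasure (ν.map g) := Measure.isProbabilityMeasure_map hg.aemeasurable
  exact csInf_le ⟨0, fun _ hx => hx.1.le⟩ ⟨fp.1, ⟨f, hf, fi, fp.dist_le⟩, ⟨g, hg, gi,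
    gp.symm.dist_le⟩⟩

lemma Delta_nonneg (μ : Measure X) (ν : Measure Y) : 0 ≤ DeltaGHwt X Y μ ν :=
  Real.sInf_nonneg fun _ hx => hx.1.le

lemma half_of_Delta_lt [CompactSpace X] [CompactSpace Y] [Nonempty X] [Nonempty Y]
    {μ : Measure X} {ν : Measure Y} [IsProbabilityMeasure μ]
    [IsProbabilityMeasure ν] {ε : ℝ} (h : DeltaGHwt X Y μ ν < ε) :
    Half μ ν ε ∧ Half ν μ ε := by
  have hne : {ε : ℝ | 0 < ε ∧
    (∃ f : X → Y, Measurable f ∧ IsEpsIsometry f ε ∧ prohorovDist (μ.map f) ν ≤ ε) ∧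
    (∃ g : Y → X, Measurable g ∧ IsEpsIsometry g ε ∧ prohorovDist μ (ν.map g) ≤ ε)}.Nonempty := by
    obtain ⟨f, hf, fi, fp⟩ := Half.const μ ν
    obtain ⟨g, hg, gi, gp⟩ := (Half.const ν μ).mono
      (δ := 1 + diam (univ : Set X) + diam (univ : Set Y)) (by linarith)
    haveI : IsProbabilityMeasure (ν.map g) := Measure.isProbabilityMeasure_map hg.aemeasurable
    exact ⟨_, fp.1, ⟨f, hf, fi, fp.dist_le⟩, ⟨g, hg, gi, gp.symm.dist_le⟩⟩
  obtain ⟨δ, ⟨hδ, ⟨f, hf, fi, fp⟩, ⟨g, hg, gi, gp⟩⟩, hlt⟩ := exists_lt_of_csInf_lt hne h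
  haveI : IsProbabilityMeasure (μ.map f) := Measure.isProbabilityMeasure_map hf.aemeasurable
  haveI : IsProbabilityMeasure (ν.map g) := Measure.isProbabilityMeasure_map hg.aemeasurable
  constructor
  · exact ⟨f, hf, ⟨fun x y => (fi.1 x y).trans hlt.le,
      fun y => (fi.2 y).imp fun x hx => hx.trans hlt.le⟩, PP.of_dist_lt (fp.trans_lt hlt)⟩
  · exact ⟨g, hg, ⟨fun x y => (gi.1 x y).trans hlt.le,
      fun y => (gi.2 y).imp fun x hx => hx.trans hlt.le⟩, (PP.of_dist_lt (gp.trans_lt hlt)).symm⟩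

lemma exists_isometry [CompactSpace X] [CompactSpace Y]
    {μ : Measure X} {ν : Measure Y} [IsProbabilityMeasure μ]
    [IsProbabilityMeasure ν] (h : ∀ ε > 0, Half μ ν ε) :
    ∃ φ : X → Y, Isometry φ ∧ Function.Surjective φ ∧ μ.map φ = ν := by
  have hpos : ∀ n : ℕ, (0 : ℝ) < 1 / ((n : ℝ) + 1) := fun n => Nat.one_div_pos_of_nat
  choose f hf fi fp using fun n : ℕ => h _ (hpos n)
  let U : Ultrafilter ℕ := Ultrafilter.of atTop
  have hU : (U : Filter ℕ) ≤ atTop := Ultrafilter.of_le _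
  have he : Tendsto (fun n : ℕ => 1 / ((n : ℝ) + 1)) U (𝓝 0) :=
    tendsto_one_div_add_atTop_nhds_zero_nat.mono_left hU
  have hlimit : ∀ x : X, ∃ a, Tendsto (fun n => f n x) U (𝓝 a) := by
    intro x
    obtain ⟨a, -, ha⟩ := isCompact_univ.ultrafilter_le_nhds (U.map fun n => f n x) (by simp)
    exact ⟨a, ha⟩
  choose φ hφ using hlimit
  have hiso : Isometry φ := by
    refine Isometry.of_dist_eq fun x y => ?_
    have h1 : Tendsto (fun n => dist (f n x) (f n y)) U (𝓝 (dist (φ x) (φ y))) :=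
      (hφ x).dist (hφ y)
    have h2 : Tendsto (fun n => dist x y - dist (f n x) (f n y)) U (𝓝 0) :=
      squeeze_zero_norm (fun n => (fi n).1 x y) he
    have h3 := h1.add h2
    simp only [add_sub_cancel, add_zero] at h3
    exact (tendsto_nhds_unique h3 tendsto_const_nhds)
  have hsurj : Function.Surjective φ := by
    intro y
    choose u hu using fun n => (fi n).2 y
    obtain ⟨x, -, hx⟩ := isCompact_univ.ultrafilter_le_nhds (U.map u) (by simp)
    have hx : Tendsto u U (𝓝 x) := hx
    refine ⟨x, ?_⟩
    have hb : ∀ n : ℕ, dist (φ x) y ≤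
        dist (φ x) (f n x) + (dist x (u n) + 1 / ((n : ℝ) + 1)) + 1 / ((n : ℝ) + 1) := by
      intro n
      have t1 := dist_triangle (φ x) (f n x) y
      have t2 := dist_triangle (f n x) (f n (u n)) y
      have t3 := hu n
      rw [dist_comm] at t3
      have t4 := (abs_le.1 ((fi n).1 x (u n))).1
      linarith
    have hlim : Tendsto (fun n : ℕ =>
        dist (φ x) (f n x) + (dist x (u n) + 1 / ((n : ℝ) + 1)) + 1 / ((n : ℝ) + 1)) U
        (𝓝 (dist (φ x) (φ x) + (dist x x + 0) + 0)) :=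
      ((tendsto_const_nhds.dist (hφ x)).add ((tendsto_const_nhds.dist hx).add he)).add he
    simp only [dist_self, add_zero] at hlim
    exact dist_le_zero.1 (ge_of_tendsto' hlim hb)
  refine ⟨φ, hiso, hsurj, ?_⟩
  haveI : IsProbabilityMeasure (μ.map φ) :=
    Measure.isProbabilityMeasure_map hiso.continuous.measurable.aemeasurable
  refine PP.eq fun ε hε => ?_
  have hδ : 0 < ε / 8 := by linarith
  obtain ⟨t, -, ht, hcov⟩ := finite_cover_balls_of_compact (isCompact_univ (X := X)) hδ
  have ev1 : ∀ᶠ n in (U : Filter ℕ), ∀ x ∈ t, dist (φ x) (f n x) < ε / 8 := by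
    rw [ht.eventually_all]
    intro x _
    have := (tendsto_const_nhds (x := φ x)).dist (hφ x)
    rw [dist_self] at this
    exact this.eventually_lt_const hδ
  have ev2 : ∀ᶠ n : ℕ in (U : Filter ℕ), 1 / ((n : ℝ) + 1) < ε / 8 := he.eventually_lt_const hδ
  obtain ⟨n, h1, h2⟩ := (ev1.and ev2).exists
  have hclose : ∀ x, dist (φ x) (f n x) < ε / 2 := by
    intro x
    have hx := hcov (mem_univ x)
    simp only [mem_iUnion, mem_ball, exists_prop] at hx
    obtain ⟨z, hz, hxz⟩ := hx
    have t1 := dist_triangle4 (φ x) (φ z) (f n z) (f n x)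
    rw [hiso.dist_eq] at t1
    have t2 := h1 z hz
    have t4 := (abs_le.1 ((fi n).1 z x)).1
    rw [dist_comm z x] at t4
    linarith
  exact ((PP.map_close hiso.continuous.measurable (hf n) (by linarith) hclose).trans
    (fp n)).mono (by linarith)

end half

section trees

lemma T_nonneg (X Y : WtRealTree) : 0 ≤ X.Delta Y := by
  letI : MeasurableSpace X.carrier := borel X.carrier
  letI : MeasurableSpace Y.carrier := borel Y.carrier
  haveI : BorelSpace X.carrier := ⟨rfl⟩
  haveI : BorelSpace Y.carrier := ⟨rfl⟩
  exact Delta_nonneg X.ν Y.ν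

/-- One-sided approximation between trees. -/
def THalf (X Y : WtRealTree) (ε : ℝ) : Prop :=
  letI : MeasurableSpace X.carrier := borel X.carrier
  letI : MeasurableSpace Y.carrier := borel Y.carrier
  Half X.ν Y.ν ε

lemma T_le {X Y : WtRealTree} {ε : ℝ} (h : THalf X Y ε) (h' : THalf Y X ε) :
    X.Delta Y ≤ ε := by
  letI : MeasurableSpace X.carrier := borel X.carrier
  letI : MeasurableSpace Y.carrier := borel Y.carrier
  haveI : BorelSpace X.carrier := ⟨rfl⟩
  haveI : BorelSpace Y.carrier := ⟨rfl⟩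
  haveI := X.prob
  haveI := Y.prob
  exact Delta_le h h'

lemma T_half {X Y : WtRealTree} {ε : ℝ} (h : X.Delta Y < ε) : THalf X Y ε ∧ THalf Y X ε := by
  letI : MeasurableSpace X.carrier := borel X.carrier
  letI : MeasurableSpace Y.carrier := borel Y.carrier
  haveI : BorelSpace X.carrier := ⟨rfl⟩
  haveI : BorelSpace Y.carrier := ⟨rfl⟩
  haveI := X.prob
  haveI := Y.prob
  exact half_of_Delta_lt h

lemma THalf.comp {X Y Z : WtRealTree} {a b : ℝ} (h : THalf X Y a) (h' : THalf Y Z b) :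
    THalf X Z (2 * (a + b)) := by
  letI : MeasurableSpace X.carrier := borel X.carrier
  letI : MeasurableSpace Y.carrier := borel Y.carrier
  letI : MeasurableSpace Z.carrier := borel Z.carrier
  haveI : BorelSpace X.carrier := ⟨rfl⟩
  haveI : BorelSpace Y.carrier := ⟨rfl⟩
  haveI : BorelSpace Z.carrier := ⟨rfl⟩
  exact Half.comp h h'

lemma T_symm (X Y : WtRealTree) : X.Delta Y = Y.Delta X := by
  have key : ∀ X Y : WtRealTree, X.Delta Y ≤ Y.Delta X := fun X Y =>
    le_of_forall_gt_imp_ge_of_dense fun ε hε => T_le (T_half hε).2 (T_half hε).1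
  exact le_antisymm (key X Y) (key Y X)

lemma T_tri (X Y Z : WtRealTree) : X.Delta Z ≤ 2 * (X.Delta Y + Y.Delta Z) := by
  refine le_of_forall_pos_le_add fun ε hε => ?_
  obtain ⟨h1, h2⟩ := T_half (show X.Delta Y < X.Delta Y + ε / 4 by linarith)
  obtain ⟨h3, h4⟩ := T_half (show Y.Delta Z < Y.Delta Z + ε / 4 by linarith)
  have h5 := h4.comp h2
  rw [add_comm (Y.Delta Z + ε / 4)] at h5
  have := T_le (h1.comp h3) h5
  linarith

lemma T_eq_zero_iff (X Y : WtRealTree) : X.Delta Y = 0 ↔ X.WPIsometric Y := by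
  letI : MeasurableSpace X.carrier := borel X.carrier
  letI : MeasurableSpace Y.carrier := borel Y.carrier
  haveI : BorelSpace X.carrier := ⟨rfl⟩
  haveI : BorelSpace Y.carrier := ⟨rfl⟩
  haveI := X.prob
  haveI := Y.prob
  constructor
  · intro h
    exact exists_isometry (μ := X.ν) (ν := Y.ν) fun ε hε => (T_half (h.trans_lt hε)).1
  · rintro ⟨φ, hi, hs, hm⟩
    refine le_antisymm (le_of_forall_gt_imp_ge_of_dense fun ε hε => ?_) (T_nonneg X Y)
    let e := IsometryEquiv.mk (Equiv.ofBijective φ ⟨hi.injective, hs⟩) hi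
    have hinv : Y.ν.map e.symm = X.ν := by
      rw [← hm]
      change Measure.map e.symm (Measure.map φ X.ν) = X.ν
      rw [Measure.map_map e.symm.continuous.measurable hi.continuous.measurable]
      have : e.symm ∘ φ = id := by
        funext x
        exact e.symm_apply_apply x
      rw [this, Measure.map_id]
    refine T_le ?_ ?_
    · exact Half.of_isometry (μ := X.ν) (ν := Y.ν) hi hs hm hε
    · exact Half.of_isometry (μ := Y.ν) (ν := X.ν) e.symm.isometry e.symm.surjective hinv hε

lemma T_self (X : WtRealTree) : X.Delta X = 0 := by
  letI : MeasurableSpace X.carrier := borel X.carrier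
  rw [T_eq_zero_iff]
  exact ⟨id, isometry_id, Function.surjective_id, Measure.map_id⟩

/-- The fourth root of `Δ`. -/
noncomputable def q (X Y : WtRealTree) : ℝ := (X.Delta Y) ^ ((1 : ℝ) / 4)

lemma q_nonneg (X Y : WtRealTree) : 0 ≤ q X Y := Real.rpow_nonneg (T_nonneg X Y) _

lemma q_self (X : WtRealTree) : q X X = 0 := by
  rw [q, T_self]; norm_num

lemma q_symm (X Y : WtRealTree) : q X Y = q Y X := by rw [q, q, T_symm]

lemma q_pow (X Y : WtRealTree) : q X Y ^ 4 = X.Delta Y := by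
  rw [q, ← Real.rpow_natCast, ← Real.rpow_mul (T_nonneg X Y)]; norm_num

lemma q_four (A B C D : WtRealTree) : q A D ≤ 2 * max (q A B) (max (q B C) (q C D)) := by
  set m := max (q A B) (max (q B C) (q C D)) with hm
  have h1 : q A B ≤ m := le_max_left _ _
  have h2 : q B C ≤ m := (le_max_left _ _).trans (le_max_right _ _)
  have h3 : q C D ≤ m := (le_max_right _ _).trans (le_max_right _ _)
  have hm0 : 0 ≤ m := (q_nonneg A B).trans h1
  have p1 := pow_le_pow_left₀ (q_nonneg A B) h1 4
  have p2 := pow_le_pow_left₀ (q_nonneg B C) h2 4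
  have p3 := pow_le_pow_left₀ (q_nonneg C D) h3 4
  rw [q_pow] at p1 p2 p3
  have t1 := T_tri A B D
  have t2 := T_tri B C D
  have hm4 : 0 ≤ m ^ 4 := by positivity
  refine le_of_pow_le_pow_left₀ (n := 4) (by norm_num) (by positivity) ?_
  rw [q_pow, mul_pow]
  linarith

/-- Chains indexed by natural numbers. -/
def chains (X Y : WtRealTree) : Set ℝ :=
  {r : ℝ | ∃ (n : ℕ) (Z : ℕ → WtRealTree), Z 0 = X ∧ Z n = Y ∧
    r = ∑ i ∈ Finset.range n, q (Z i) (Z (i + 1))}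

lemma dGHwt_eq (X Y : WtRealTree) : dGHwt X Y = sInf (chains X Y) := by
  unfold dGHwt
  congr 1
  ext r
  constructor
  · rintro ⟨n, Z, h0, h1, hr⟩
    refine ⟨n, fun k => if h : k < n + 1 then Z ⟨k, h⟩ else Y, ?_, ?_, ?_⟩
    · simpa using h0
    · rw [← h1]
      simp only [Nat.lt_succ_self, dif_pos]
      rfl
    · rw [hr, Finset.sum_range]
      refine Finset.sum_congr rfl fun i _ => ?_
      have hi := i.2
      have e1 : (i : ℕ) < n + 1 := by omega
      have e2 : (i : ℕ) + 1 < n + 1 := by omega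
      simp only [e1, e2, dif_pos]
      rfl
  · rintro ⟨n, Z, h0, h1, hr⟩
    refine ⟨n, fun k => Z k, by simpa using h0, by simpa using h1, ?_⟩
    rw [hr, Finset.sum_range]
    rfl

lemma chains_nonneg {X Y : WtRealTree} {r : ℝ} (h : r ∈ chains X Y) : 0 ≤ r := by
  obtain ⟨n, Z, -, -, rfl⟩ := h
  exact Finset.sum_nonneg fun i _ => q_nonneg _ _

lemma chains_bdd (X Y : WtRealTree) : BddBelow (chains X Y) := ⟨0, fun _ => chains_nonneg⟩

lemma q_mem (X Y : WtRealTree) : q X Y ∈ chains X Y :=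
  ⟨1, fun k => if k = 0 then X else Y, by simp, by simp, by simp⟩

lemma chains_symm {X Y : WtRealTree} {r : ℝ} (h : r ∈ chains X Y) : r ∈ chains Y X := by
  obtain ⟨n, Z, h0, h1, rfl⟩ := h
  refine ⟨n, fun k => Z (n - k), by simpa using h1, by simpa using h0, ?_⟩
  rw [← Finset.sum_range_reflect]
  refine Finset.sum_congr rfl fun i hi => ?_
  have hi := Finset.mem_range.1 hi
  rw [q_symm]
  congr 2
  all_goals omega

lemma chains_add {X Y W : WtRealTree} {r s : ℝ} (h : r ∈ chains X Y) (h' : s ∈ chains Y W) :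
    r + s ∈ chains X W := by
  obtain ⟨n, Z, h0, h1, rfl⟩ := h
  obtain ⟨m, V, h2, h3, rfl⟩ := h'
  have hv : ∀ k, (if n + k ≤ n then Z (n + k) else V (n + k - n)) = V k := by
    intro k
    split_ifs with hk
    · obtain rfl : k = 0 := by omega
      rw [add_zero, h1, h2]
    · congr 1; omega
  refine ⟨n + m, fun k => if k ≤ n then Z k else V (k - n), by simpa using h0, ?_, ?_⟩
  · exact (hv m).trans h3
  · rw [Finset.sum_range_add]
    congr 1
    · refine Finset.sum_congr rfl fun i hi => ?_
      have hi := Finset.mem_range.1 hi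
      simp only [if_pos hi.le, if_pos (Nat.succ_le_of_lt hi)]
    · refine Finset.sum_congr rfl fun i _ => ?_
      have e1 := hv i
      have e2 := hv (i + 1)
      rw [← add_assoc] at e2
      simp only [e1, e2]

lemma q_le_two_mul {X Y : WtRealTree} {r : ℝ} (h : r ∈ chains X Y) : q X Y ≤ 2 * r := by
  obtain ⟨n, Z, rfl, rfl, rfl⟩ := h
  let d : WtRealTree → WtRealTree → NNReal := fun A B => ⟨q A B, q_nonneg A B⟩
  have d0 : ∀ A, d A A = 0 := fun A => NNReal.eq (q_self A)
  have ds : ∀ A B, d A B = d B A := fun A B => NNReal.eq (q_symm A B)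
  have d4 : ∀ A B C D, d A D ≤ 2 * max (d A B) (max (d B C) (d C D)) := by
    intro A B C D
    rw [← NNReal.coe_le_coe]
    push_cast
    exact q_four A B C D
  have h1 := PseudoMetricSpace.le_two_mul_dist_ofPreNNDist d d0 ds d4 (Z 0) (Z n)
  have h2 := PseudoMetricSpace.dist_ofPreNNDist_le d d0 ds
  letI : PseudoMetricSpace WtRealTree := PseudoMetricSpace.ofPreNNDist d d0 ds
  have h3 : dist (Z 0) (Z n) ≤ ∑ i ∈ Finset.range n, q (Z i) (Z (i + 1)) :=
    dist_le_range_sum_of_dist_le n fun {k} _ => h2 (Z k) (Z (k + 1))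
  have h4 : q (Z 0) (Z n) ≤ 2 * dist (Z 0) (Z n) := h1
  linarith

end trees

end GHAux

/-- `d_GHwt` is a metric on the space of weight-preserving isometry classes of weighted
compact real trees (nonnegative, symmetric, triangle inequality, and it vanishes exactly
on weight-preserving isometric pairs), and it satisfies
`(1/2) Δ_GHwt(X,Y)^{1/4} ≤ d_GHwt(X,Y) ≤ Δ_GHwt(X,Y)^{1/4}`. -/
theorem dGHwt_is_metric_and_bounds :
    (∀ X Y : WtRealTree, 0 ≤ dGHwt X Y) ∧
    (∀ X Y : WtRealTree, dGHwt X Y = dGHwt Y X) ∧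
    (∀ X Y Z : WtRealTree, dGHwt X Z ≤ dGHwt X Y + dGHwt Y Z) ∧
    (∀ X Y : WtRealTree, dGHwt X Y = 0 ↔ X.WPIsometric Y) ∧
    (∀ X Y : WtRealTree,
      (1 / 2) * (X.Delta Y) ^ ((1 : ℝ) / 4) ≤ dGHwt X Y ∧
        dGHwt X Y ≤ (X.Delta Y) ^ ((1 : ℝ) / 4)) := by
  have hlow : ∀ X Y : WtRealTree, (1 / 2) * GHAux.q X Y ≤ dGHwt X Y := by
    intro X Y
    rw [GHAux.dGHwt_eq]
    refine le_csInf ⟨_, GHAux.q_mem X Y⟩ fun r hr => ?_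
    linarith [GHAux.q_le_two_mul hr]
  have hup : ∀ X Y : WtRealTree, dGHwt X Y ≤ GHAux.q X Y := by
    intro X Y
    rw [GHAux.dGHwt_eq]
    exact csInf_le (GHAux.chains_bdd X Y) (GHAux.q_mem X Y)
  have hnn : ∀ X Y : WtRealTree, 0 ≤ dGHwt X Y := fun X Y =>
    le_trans (by have := GHAux.q_nonneg X Y; positivity) (hlow X Y)
  refine ⟨hnn, ?_, ?_, ?_, fun X Y => ⟨hlow X Y, hup X Y⟩⟩
  · intro X Y
    rw [GHAux.dGHwt_eq, GHAux.dGHwt_eq]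
    congr 1
    exact Set.ext fun r => ⟨GHAux.chains_symm, GHAux.chains_symm⟩
  · intro X Y Z
    refine le_of_forall_pos_le_add fun ε hε => ?_
    rw [GHAux.dGHwt_eq X Y, GHAux.dGHwt_eq Y Z, GHAux.dGHwt_eq X Z]
    obtain ⟨r, hr, hr'⟩ := Real.lt_sInf_add_pos ⟨_, GHAux.q_mem X Y⟩ (half_pos hε)
    obtain ⟨s, hs, hs'⟩ := Real.lt_sInf_add_pos ⟨_, GHAux.q_mem Y Z⟩ (half_pos hε)
    have := csInf_le (GHAux.chains_bdd X Z) (GHAux.chains_add hr hs)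
    linarith
  · intro X Y
    rw [← GHAux.T_eq_zero_iff, ← GHAux.q_pow]
    have h1 := hlow X Y
    have h2 := hup X Y
    have h3 := hnn X Y
    have h4 := GHAux.q_nonneg X Y
    constructor
    · intro h
      have : GHAux.q X Y = 0 := by linarith
      simp [this]
    · intro h
      have : GHAux.q X Y = 0 := by simpa using h
      linarith
end

section
/- The metric space (T^wt, d_GHwt) of weight-preserving isometry classes of weighted compact real trees, equipped with the weighted Gromov–Hausdorff metric d_GHwt, is complete and separable. -/
open Metric Set

/-- `T^wt`: the space of weight-preserving isometry classes of weighted compact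
real trees. -/
def Twt : Type 1 := Quot WtRealTree.WPIsometric

/-- The weighted Gromov–Hausdorff distance on `T^wt`, computed on representatives. -/
noncomputable def distTwt (a b : Twt) : ℝ := dGHwt a.out b.out

open MeasureTheory

section general

lemma wt_discretize {X : Type*} [MetricSpace X] [CompactSpace X] [MeasurableSpace X]
    [BorelSpace X] {δ : ℝ} (hδ : 0 < δ) :
    ∃ (k : ℕ) (p : Fin k → X) (q : X → Fin k), Measurable q ∧ ∀ x, dist x (p (q x)) ≤ δ := by
  classical
  obtain ⟨t, -, htf, ht⟩ := finite_cover_balls_of_compact (isCompact_univ (X := X)) hδ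
  obtain ⟨k, p, hp⟩ := htf.fin_param
  have hcov : ∀ x : X, ∃ n : ℕ, ∃ h : n < k, dist x (p ⟨n, h⟩) < δ := by
    intro x
    have := ht (mem_univ x)
    simp only [mem_iUnion, mem_ball] at this
    obtain ⟨y, hy, hxy⟩ := this
    rw [← hp.2] at hy
    obtain ⟨i, rfl⟩ := hy
    exact ⟨i.1, i.2, hxy⟩
  have hm := measurable_find hcov (fun n => by
    by_cases h : n < k
    · simp only [h, exists_true_left]
      exact (isOpen_lt (by fun_prop) (by fun_prop)).measurableSet
    · simp [h])
  have hs := fun x => Nat.find_spec (hcov x)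
  refine ⟨k, p, fun x => ⟨Nat.find (hcov x), (hs x).1⟩, ?_, fun x => (hs x).2.le⟩
  refine measurable_to_countable' fun i => ?_
  have : (fun x => (⟨Nat.find (hcov x), (hs x).1⟩ : Fin k)) ⁻¹' {i}
      = (fun x => Nat.find (hcov x)) ⁻¹' {i.1} := by
    ext x; simp [Fin.ext_iff]
  rw [this]
  exact hm (measurableSet_singleton _)

/-- closeness of measures -/
def PClose {X : Type*} [MetricSpace X] [MeasurableSpace X] (μ ν : Measure X) (ε : ℝ) : Prop :=
  ∀ C : Set X, IsClosed C → μ C ≤ ν (Metric.thickening ε C) + ENNReal.ofReal ε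

lemma PClose.mono {X : Type*} [MetricSpace X] [MeasurableSpace X] {μ ν : Measure X} {ε ε' : ℝ}
    (h : PClose μ ν ε) (hε : ε ≤ ε') : PClose μ ν ε' := fun C hC =>
  (h C hC).trans (add_le_add (measure_mono (thickening_mono hε C)) (ENNReal.ofReal_le_ofReal hε))

lemma PClose.dist_le {X : Type*} [MetricSpace X] [MeasurableSpace X] {μ ν : Measure X} {ε : ℝ}
    (h : PClose μ ν ε) (hε : 0 < ε) : prohorovDist μ ν ≤ ε :=
  csInf_le ⟨0, fun _ h => h.1.le⟩ ⟨hε, h⟩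

lemma PClose.symm {X : Type*} [MetricSpace X] [MeasurableSpace X] [BorelSpace X]
    {μ ν : Measure X} [IsProbabilityMeasure μ] [IsProbabilityMeasure ν] {ε : ℝ}
    (h : PClose μ ν ε) : PClose ν μ ε := by
  intro C hC
  have h1 := h (thickening ε C)ᶜ isOpen_thickening.isClosed_compl
  have h2 : thickening ε (thickening ε C)ᶜ ⊆ Cᶜ := by
    intro x hx hxC
    obtain ⟨z, hz, hxz⟩ := mem_thickening_iff.1 hx
    exact hz (mem_thickening_iff.2 ⟨x, hxC, by rwa [dist_comm]⟩)
  have h3 := h1.trans (add_le_add (measure_mono h2) le_rfl)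
  have e1 := prob_add_prob_compl (μ := μ) (isOpen_thickening (δ := ε) (E := C)).measurableSet
  have e2 := prob_add_prob_compl (μ := ν) hC.measurableSet
  have : ν C + ν Cᶜ ≤ (μ (thickening ε C) + ENNReal.ofReal ε) + ν Cᶜ := by
    rw [e2, ← e1, add_assoc, add_comm (ENNReal.ofReal ε)]
    gcongr
  exact (ENNReal.add_le_add_iff_right (measure_ne_top _ _)).1 this

lemma key_delta {X Y : Type*} [MetricSpace X] [CompactSpace X] [Nonempty X] [MeasurableSpace X]
    [BorelSpace X] [MetricSpace Y] [CompactSpace Y] [MeasurableSpace Y] [BorelSpace Y]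
    {μ : Measure X} {ν : Measure Y} [IsProbabilityMeasure μ] [IsProbabilityMeasure ν]
    {f : X → Y} (hf : Measurable f) {δ : ℝ} (hδ : 0 < δ) (hi : IsEpsIsometry f δ)
    (hp : PClose (μ.map f) ν δ) :
    DeltaGHwt X Y μ ν ≤ 5 * δ ∧ DeltaGHwt Y X ν μ ≤ 5 * δ := by
  obtain ⟨k, p, q, hq, hpq⟩ := wt_discretize (X := Y) hδ
  choose h hh using hi.2
  have hd := hi.1
  set g : Y → X := fun y => h (p (q y)) with hg
  have hgm : Measurable g := (measurable_of_countable (fun i => h (p i))).comp hq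
  have hfg : ∀ y, dist y (f (g y)) ≤ 2 * δ := fun y => by
    have := dist_triangle y (p (q y)) (f (g y))
    have := hpq y
    have := hh (p (q y))
    linarith
  have hgi : IsEpsIsometry g (5 * δ) := by
    constructor
    · intro y y'
      have h1 := hd (g y) (g y')
      have h2 := hfg y
      have h3 := hfg y'
      have h4 := dist_triangle4 y (f (g y)) (f (g y')) y'
      have h5 := dist_triangle4 (f (g y)) y y' (f (g y'))
      rw [dist_comm (f (g y')) y'] at h4
      rw [dist_comm (f (g y)) y] at h5
      rw [abs_le] at *
      constructor <;> linarith
    · intro x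
      refine ⟨f x, ?_⟩
      have h1 := abs_le.1 (hd x (g (f x)))
      have h2 := hfg (f x)
      linarith
  have hgp : PClose μ (ν.map g) (5 * δ) := by
    intro C hC
    have h1 := hp (closure (f '' C)) isClosed_closure
    rw [Measure.map_apply hf isClosed_closure.measurableSet, thickening_closure] at h1
    rw [Measure.map_apply hgm isOpen_thickening.measurableSet]
    refine (measure_mono (show C ⊆ f ⁻¹' closure (f '' C) from
      fun x hx => subset_closure (mem_image_of_mem f hx))).trans
      (h1.trans (add_le_add (measure_mono ?_) (ENNReal.ofReal_le_ofReal (by linarith))))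
    intro y hy
    obtain ⟨_, ⟨c, hc, rfl⟩, hyc⟩ := mem_thickening_iff.1 hy
    refine mem_thickening_iff.2 ⟨c, hc, ?_⟩
    have h1 := abs_le.1 (hd (g y) c)
    have h2 := hfg y
    have h3 := dist_triangle_left (f (g y)) (f c) y
    linarith
  have hfi : IsEpsIsometry f (5 * δ) :=
    ⟨fun x y => (hd x y).trans (by linarith), fun y => (hi.2 y).imp fun x hx => hx.trans (by linarith)⟩
  have hfp : PClose (μ.map f) ν (5 * δ) := hp.mono (by linarith)
  have : IsProbabilityMeasure (μ.map f) := Measure.isProbabilityMeasure_map hf.aemeasurable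
  have : IsProbabilityMeasure (ν.map g) := Measure.isProbabilityMeasure_map hgm.aemeasurable
  have h5 : 0 < 5 * δ := by linarith
  exact ⟨csInf_le ⟨0, fun _ h => h.1.le⟩
      ⟨h5, ⟨f, hf, hfi, hfp.dist_le h5⟩, ⟨g, hgm, hgi, hgp.dist_le h5⟩⟩,
    csInf_le ⟨0, fun _ h => h.1.le⟩
      ⟨h5, ⟨g, hgm, hgi, hgp.symm.dist_le h5⟩, ⟨f, hf, hfi, hfp.symm.dist_le h5⟩⟩⟩

lemma delta_nonneg {X Y : Type*} [MetricSpace X] [MeasurableSpace X]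
    [MetricSpace Y] [MeasurableSpace Y] (μ : Measure X) (ν : Measure Y) :
    0 ≤ DeltaGHwt X Y μ ν := Real.sInf_nonneg fun _ h => h.1.le

lemma delta_set_nonempty {X Y : Type*} [MetricSpace X] [CompactSpace X] [Nonempty X]
    [MeasurableSpace X] [BorelSpace X]
    [MetricSpace Y] [CompactSpace Y] [Nonempty Y] [MeasurableSpace Y] [BorelSpace Y]
    (μ : Measure X) (ν : Measure Y) [IsProbabilityMeasure μ] [IsProbabilityMeasure ν] :
    {ε : ℝ | 0 < ε ∧
    (∃ f : X → Y, Measurable f ∧ IsEpsIsometry f ε ∧ prohorovDist (μ.map f) ν ≤ ε) ∧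
    (∃ g : Y → X, Measurable g ∧ IsEpsIsometry g ε ∧ prohorovDist μ (ν.map g) ≤ ε)}.Nonempty := by
  obtain ⟨x0⟩ := ‹Nonempty X›
  obtain ⟨y0⟩ := ‹Nonempty Y›
  have bX : ∀ x y : X, dist x y ≤ diam (univ : Set X) := fun x y =>
    dist_le_diam_of_mem isCompact_univ.isBounded (mem_univ _) (mem_univ _)
  have bY : ∀ x y : Y, dist x y ≤ diam (univ : Set Y) := fun x y =>
    dist_le_diam_of_mem isCompact_univ.isBounded (mem_univ _) (mem_univ _)
  have dX := diam_nonneg (s := (univ : Set X))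
  have dY := diam_nonneg (s := (univ : Set Y))
  have hpos : 0 < diam (univ : Set X) + diam (univ : Set Y) + 1 := by linarith
  refine ⟨diam (univ : Set X) + diam (univ : Set Y) + 1, hpos,
    ⟨fun _ => y0, measurable_const, ⟨fun x y => ?_, fun y => ⟨x0, ?_⟩⟩, ?_⟩,
    ⟨fun _ => x0, measurable_const, ⟨fun x y => ?_, fun y => ⟨y0, ?_⟩⟩, ?_⟩⟩
  · have := bX x y
    rw [dist_self, sub_zero, abs_of_nonneg dist_nonneg]; linarith
  · have := bY y y0
    linarith
  · refine PClose.dist_le (fun C _ => ?_) hpos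
    have : IsProbabilityMeasure (μ.map (fun _ => y0)) :=
      Measure.isProbabilityMeasure_map measurable_const.aemeasurable
    refine prob_le_one.trans (le_add_left ?_)
    rw [← ENNReal.ofReal_one]
    exact ENNReal.ofReal_le_ofReal (by linarith)
  · have := bY x y
    rw [dist_self, sub_zero, abs_of_nonneg dist_nonneg]; linarith
  · have := bX y x0
    linarith
  · refine PClose.dist_le (fun C _ => ?_) hpos
    refine prob_le_one.trans (le_add_left ?_)
    rw [← ENNReal.ofReal_one]
    exact ENNReal.ofReal_le_ofReal (by linarith)

lemma ghDist_le_delta {X Y : Type*} [MetricSpace X] [CompactSpace X] [Nonempty X]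
    [MeasurableSpace X] [BorelSpace X]
    [MetricSpace Y] [CompactSpace Y] [Nonempty Y] [MeasurableSpace Y] [BorelSpace Y]
    (μ : Measure X) (ν : Measure Y) [IsProbabilityMeasure μ] [IsProbabilityMeasure ν] :
    GromovHausdorff.ghDist X Y ≤ 2 * DeltaGHwt X Y μ ν := by
  have : GromovHausdorff.ghDist X Y / 2 ≤ DeltaGHwt X Y μ ν := by
    refine le_csInf (delta_set_nonempty μ ν) ?_
    rintro ε ⟨hε, ⟨f, -, hf, -⟩, -⟩
    have := GromovHausdorff.ghDist_le_of_approx_subsets (s := (univ : Set X)) (fun x => f x)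
      (ε₁ := 0) (ε₂ := ε) (ε₃ := ε) (fun x => ⟨x, mem_univ _, by simp⟩)
      (fun y => by obtain ⟨x, hx⟩ := hf.2 y; exact ⟨⟨x, mem_univ _⟩, hx⟩)
      (fun x y => hf.1 x y)
    linarith
  linarith

/-- Intermediate points in connected spaces with the four point condition. -/
lemma wt_exists_between {X : Type*} [MetricSpace X] [PreconnectedSpace X]
    (h4 : FourPoint (fun x y : X => dist x y)) (x y : X) {r : ℝ} (hr0 : 0 ≤ r)
    (hr : r ≤ dist x y) : ∃ w, dist x w = r ∧ dist w y = dist x y - r := by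
  rcases hr0.eq_or_lt with rfl | hr0
  · exact ⟨x, by simp, by simp⟩
  rcases hr.eq_or_lt with rfl | hr
  · exact ⟨y, by simp, by simp⟩
  by_contra hcon
  push Not at hcon
  -- twice the Gromov product at `x`
  let G : X → X → ℝ := fun a b => dist x a + dist x b - dist a b
  have hG : ∀ a b c, G a b ≤ G a c ∨ G b c ≤ G a c := by
    intro a b c
    have := h4 a c x b
    simp only [G]
    simp only at this
    rcases le_max_iff.1 this with h | h
    · right
      rw [dist_comm a x, dist_comm c b] at h
      linarith
    · left
      rw [dist_comm c x] at h
      linarith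
  have hGc : Continuous fun w => G w y := by simp only [G]; fun_prop
  have hGs : ∀ a b, G a b = G b a := fun a b => by
    simp only [G]; rw [dist_comm a b]; ring
  have hopen : IsOpen {w | G w y ≤ 2 * r} := by
    rw [Metric.isOpen_iff]
    intro w hw
    rcases (show G w y ≤ 2 * r from hw).lt_or_eq with hlt | heq
    · obtain ⟨ε, hε, hb⟩ := Metric.isOpen_iff.1 (isOpen_lt hGc continuous_const) w
        (show G w y < 2 * r from hlt)
      exact ⟨ε, hε, fun z hz => by
        have h : G z y < 2 * r := hb hz
        exact h.le⟩
    · have hwr : r < dist x w := by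
        by_contra hle
        push Not at hle
        have h1 : dist x y ≤ dist x w + dist w y := dist_triangle _ _ _
        simp only [G] at heq
        have h2 : dist x w = r := by linarith
        exact hcon w h2 (by linarith)
      refine ⟨dist x w - r, by linarith, fun z hz => ?_⟩
      rw [mem_ball] at hz
      have h3 : 2 * r < G w z := by
        simp only [G]
        have := dist_triangle x z w
        rw [dist_comm w z]
        linarith
      show G z y ≤ 2 * r
      by_contra hgt
      push Not at hgt
      rcases hG w z y with h | h <;> linarith
  have hopen2 : IsOpen {w | 2 * r < G w y} := isOpen_lt continuous_const hGc
  have := isPreconnected_univ (α := X) _ _ hopen hopen2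
    (fun w _ => (le_or_gt (G w y) (2 * r)).imp id id)
    ⟨x, mem_univ _, by simp only [G, mem_ofPred_eq]; rw [dist_self]; linarith⟩
    ⟨y, mem_univ _, by simp only [G, mem_ofPred_eq]; rw [dist_self]; linarith⟩
  obtain ⟨w, -, h1, h2⟩ := this
  have h1' : G w y ≤ 2 * r := h1
  have h2' : 2 * r < G w y := h2
  linarith

lemma pathConnected_of_fourPoint {X : Type*} [MetricSpace X] [PreconnectedSpace X] [Nonempty X]
    (h4 : FourPoint (fun x y : X => dist x y)) : PathConnectedSpace X := by
  refine ⟨‹_›, fun x y => ?_⟩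
  have hex : ∀ t : unitInterval, ∃ w, dist x w = t * dist x y ∧
      dist w y = dist x y - t * dist x y := fun t =>
    wt_exists_between h4 x y (mul_nonneg t.2.1 dist_nonneg)
      (mul_le_of_le_one_left dist_nonneg t.2.2)
  choose γ h1 h2 using hex
  have hlip : LipschitzWith (nndist x y) γ := by
    refine LipschitzWith.of_dist_le_mul fun s t => ?_
    have h := h4 (γ s) (γ t) x y
    simp only at h
    rw [dist_comm (γ s) x, dist_comm (γ t) x, h1, h1, h2, h2] at h
    rw [coe_nndist, Subtype.dist_eq, Real.dist_eq]
    have hd : 0 ≤ dist x y := dist_nonneg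
    rcases le_max_iff.1 h with h | h
    · have := mul_le_mul_of_nonneg_left (le_abs_self ((s : ℝ) - t)) hd
      linarith
    · have := mul_le_mul_of_nonneg_left (neg_abs_le ((s : ℝ) - t)) hd
      linarith
  refine ⟨⟨⟨γ, hlip.continuous⟩, ?_, ?_⟩⟩
  · have := h1 0
    simp only [Set.Icc.coe_zero, zero_mul] at this
    exact (dist_eq_zero.1 this).symm
  · have := h2 1
    simp only [Set.Icc.coe_one, one_mul, sub_self] at this
    exact dist_eq_zero.1 this

end general

section limits

lemma gh_maps {X Y : Type*} [MetricSpace X] [CompactSpace X] [Nonempty X]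
    [MetricSpace Y] [CompactSpace Y] [Nonempty Y] {ε : ℝ}
    (h : GromovHausdorff.ghDist X Y < ε) : ∃ f : X → Y, IsEpsIsometry f (2 * ε) := by
  obtain ⟨Φ, Ψ, hΦ, hΨ, he⟩ := GromovHausdorff.ghDist_eq_hausdorffDist X Y
  rw [he] at h
  have hfin : hausdorffEDist (range Φ) (range Ψ) ≠ ⊤ :=
    hausdorffEDist_ne_top_of_nonempty_of_bounded (range_nonempty _) (range_nonempty _)
      (isCompact_range hΦ.continuous).isBounded (isCompact_range hΨ.continuous).isBounded
  have h1 : ∀ x, ∃ y, dist (Φ x) (Ψ y) < ε := fun x => by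
    obtain ⟨_, ⟨y, rfl⟩, hy⟩ := exists_dist_lt_of_hausdorffDist_lt (mem_range_self x) h hfin
    exact ⟨y, hy⟩
  have h2 : ∀ y, ∃ x, dist (Φ x) (Ψ y) < ε := fun y => by
    obtain ⟨_, ⟨x, rfl⟩, hx⟩ := exists_dist_lt_of_hausdorffDist_lt' (mem_range_self y) h hfin
    exact ⟨x, hx⟩
  choose f hf using h1
  refine ⟨f, fun x y => ?_, fun y => ?_⟩
  · have a := dist_triangle4 (Φ x) (Ψ (f x)) (Ψ (f y)) (Φ y)
    have b := dist_triangle4 (Ψ (f x)) (Φ x) (Φ y) (Ψ (f y))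
    have c := hf x
    have d := hf y
    rw [dist_comm (Ψ (f y)) (Φ y)] at a
    rw [dist_comm (Ψ (f x)) (Φ x)] at b
    rw [← hΦ.dist_eq, ← hΨ.dist_eq, abs_le]
    constructor <;> linarith
  · obtain ⟨x, hx⟩ := h2 y
    refine ⟨x, ?_⟩
    have := dist_triangle_left (Ψ y) (Ψ (f x)) (Φ x)
    have := hf x
    rw [← hΨ.dist_eq]
    linarith

lemma gh_maps_meas {X Y : Type*} [MetricSpace X] [CompactSpace X] [Nonempty X]
    [MeasurableSpace X] [BorelSpace X] [MeasurableSpace Y]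
    [MetricSpace Y] [CompactSpace Y] [Nonempty Y] {ε : ℝ} (hε : 0 < ε)
    (h : GromovHausdorff.ghDist X Y < ε) :
    ∃ f : X → Y, Measurable f ∧ IsEpsIsometry f (5 * ε) := by
  obtain ⟨f, hf, hn⟩ := gh_maps h
  obtain ⟨k, p, q, hq, hpq⟩ := wt_discretize (X := X) hε
  refine ⟨fun x => f (p (q x)), (measurable_of_countable (fun i => f (p i))).comp hq,
    fun x y => ?_, fun y => ?_⟩
  · have a := dist_triangle4 x (p (q x)) (p (q y)) y
    have b := dist_triangle4 (p (q x)) x y (p (q y))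
    rw [dist_comm (p (q y)) y] at a
    rw [dist_comm (p (q x)) x] at b
    have := hpq x
    have := hpq y
    have := abs_le.1 (hf (p (q x)) (p (q y)))
    rw [abs_le]
    constructor <;> linarith
  · obtain ⟨x, hx⟩ := hn y
    refine ⟨x, ?_⟩
    have := dist_triangle y (f x) (f (p (q x)))
    have := abs_le.1 (hf x (p (q x)))
    have := hpq x
    linarith

lemma limit_tree {L : Type*} [MetricSpace L] [CompactSpace L] [Nonempty L]
    (H : ∀ ε : ℝ, 0 < ε → ∃ X : WtRealTree, ∃ f : X.carrier → L, IsEpsIsometry f ε) :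
    IsRealTree L := by
  have h4 : FourPoint (fun x y : L => dist x y) := by
    intro a b c d
    refine le_of_forall_pos_le_add fun ε hε => ?_
    obtain ⟨X, f, hf, hn⟩ := H (ε / 12) (by linarith)
    choose h hh using hn
    have key : ∀ a b, |dist a b - dist (h a) (h b)| ≤ 3 * (ε / 12) := fun a b => by
      have h1 := dist_triangle4 a (f (h a)) (f (h b)) b
      have h2 := dist_triangle4 (f (h a)) a b (f (h b))
      rw [dist_comm (f (h b)) b] at h1
      rw [dist_comm (f (h a)) a] at h2
      have := hh a
      have := hh b
      have := abs_le.1 (hf (h a) (h b))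
      rw [abs_le]
      constructor <;> linarith
    have k1 := abs_le.1 (key a b)
    have k2 := abs_le.1 (key c d)
    have k3 := abs_le.1 (key a c)
    have k4 := abs_le.1 (key b d)
    have k5 := abs_le.1 (key a d)
    have k6 := abs_le.1 (key b c)
    have := X.tree.2.2 (h a) (h b) (h c) (h d)
    simp only at this ⊢
    rcases le_max_iff.1 this with t | t
    · have := le_max_left (dist a c + dist b d) (dist a d + dist b c)
      linarith
    · have := le_max_right (dist a c + dist b d) (dist a d + dist b c)
      linarith
  have hc : PreconnectedSpace L := by
    rw [preconnectedSpace_iff_clopen]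
    intro s hs
    by_contra hcon
    push Not at hcon
    obtain ⟨⟨a, ha⟩, hne⟩ := hcon
    obtain ⟨b, hb⟩ := (Set.ne_univ_iff_exists_notMem s).1 hne
    obtain ⟨δ, hδ, hsub⟩ := hs.1.isCompact.exists_thickening_subset_open hs.2 (le_refl s)
    have hsep : ∀ x ∈ s, ∀ y, dist x y < δ → y ∈ s := fun x hx y hxy =>
      hsub (mem_thickening_iff.2 ⟨x, hx, by rwa [dist_comm]⟩)
    obtain ⟨X, f, hf, hn⟩ := H (δ / 3) (by linarith)
    have hstep : ∀ w w', dist w w' < δ / 3 → dist (f w) (f w') < δ := fun w w' hw => by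
      have := abs_le.1 (hf w w')
      linarith
    have := X.tree.2.1
    have hclop : IsClopen (f ⁻¹' s) := by
      constructor
      · rw [← isOpen_compl_iff, Metric.isOpen_iff]
        intro w hw
        refine ⟨δ / 3, by linarith, fun z hz hzs => hw ?_⟩
        exact hsep _ hzs _ (hstep _ _ (mem_ball.1 hz))
      · rw [Metric.isOpen_iff]
        intro w hw
        refine ⟨δ / 3, by linarith, fun z hz => ?_⟩
        exact hsep _ hw _ (hstep _ _ (by rw [dist_comm]; exact mem_ball.1 hz))
    obtain ⟨xa, hxa⟩ := hn a
    obtain ⟨xb, hxb⟩ := hn b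
    have m1 : xa ∈ f ⁻¹' s := hsep _ ha _ (by linarith)
    have m2 : xb ∉ f ⁻¹' s := fun h => hb (hsep _ h _ (by rw [dist_comm]; linarith))
    rcases isClopen_iff.1 hclop with h | h
    · rw [h] at m1; exact m1
    · rw [h] at m2; exact m2 (mem_univ _)
  exact ⟨inferInstance, pathConnected_of_fourPoint h4, h4⟩

end limits

namespace WtRealTree

instance instMS (X : WtRealTree) : MeasurableSpace X.carrier := borel X.carrier
instance instBS (X : WtRealTree) : BorelSpace X.carrier := ⟨rfl⟩
instance instPM (X : WtRealTree) : IsProbabilityMeasure X.ν := X.prob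

lemma delta_def (X Y : WtRealTree) : Delta X Y = DeltaGHwt X.carrier Y.carrier X.ν Y.ν := rfl

lemma delta_nn (X Y : WtRealTree) : 0 ≤ Delta X Y := delta_nonneg _ _

lemma delta_rpow_nn (X Y : WtRealTree) : 0 ≤ Delta X Y ^ ((1 : ℝ) / 4) :=
  Real.rpow_nonneg (delta_nn X Y) _

lemma gh_le_delta (X Y : WtRealTree) :
    GromovHausdorff.ghDist X.carrier Y.carrier ≤ 2 * Delta X Y := ghDist_le_delta X.ν Y.ν

lemma dGHwt_bdd (X Y : WtRealTree) :
    BddBelow {r : ℝ | ∃ (n : ℕ) (Z : Fin (n + 1) → WtRealTree), Z 0 = X ∧ Z (Fin.last n) = Y ∧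
    r = ∑ i : Fin n, (WtRealTree.Delta (Z i.castSucc) (Z i.succ)) ^ ((1 : ℝ) / 4)} := by
  refine ⟨0, ?_⟩
  rintro r ⟨n, Z, -, -, rfl⟩
  exact Finset.sum_nonneg fun i _ => delta_rpow_nn _ _

lemma dGHwt_nonempty (X Y : WtRealTree) :
    {r : ℝ | ∃ (n : ℕ) (Z : Fin (n + 1) → WtRealTree), Z 0 = X ∧ Z (Fin.last n) = Y ∧
    r = ∑ i : Fin n, (WtRealTree.Delta (Z i.castSucc) (Z i.succ)) ^ ((1 : ℝ) / 4)}.Nonempty :=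
  ⟨_, 1, ![X, Y], rfl, rfl, rfl⟩

lemma dGHwt_le (X Y : WtRealTree) : dGHwt X Y ≤ Delta X Y ^ ((1 : ℝ) / 4) := by
  refine csInf_le (dGHwt_bdd X Y) ⟨1, ![X, Y], rfl, rfl, ?_⟩
  simp

lemma dGHwt_snoc (X Y L : WtRealTree) :
    dGHwt X L ≤ dGHwt X Y + Delta Y L ^ ((1 : ℝ) / 4) := by
  rw [← sub_le_iff_le_add]
  refine le_csInf (dGHwt_nonempty X Y) ?_
  rintro r ⟨n, Z, h0, h1, rfl⟩
  rw [sub_le_iff_le_add]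
  refine csInf_le (dGHwt_bdd X L) ⟨n + 1, Fin.snoc (α := fun _ => WtRealTree) Z L, ?_, ?_, ?_⟩
  · rw [← h0, ← Fin.castSucc_zero, Fin.snoc_castSucc]
  · simp
  · rw [Fin.sum_univ_castSucc]
    congr 1
    · refine Finset.sum_congr rfl fun i _ => ?_
      rw [Fin.snoc_castSucc, Fin.succ_castSucc, Fin.snoc_castSucc]
    · rw [Fin.snoc_castSucc, Fin.succ_last, Fin.snoc_last, h1]

lemma dist_le_fin_sum {M : Type*} [PseudoMetricSpace M] : ∀ (n : ℕ) (a : Fin (n + 1) → M),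
    dist (a 0) (a (Fin.last n)) ≤ ∑ i : Fin n, dist (a i.castSucc) (a i.succ)
  | 0, a => by simp
  | n + 1, a => by
    rw [Fin.sum_univ_castSucc]
    have h1 := dist_le_fin_sum n (fun i => a i.castSucc)
    have h2 := dist_triangle (a 0) (a (Fin.last n).castSucc) (a (Fin.last (n + 1)))
    simp only [Fin.castSucc_zero, ← Fin.succ_castSucc] at h1
    rw [Fin.succ_last]
    linarith

lemma gh_le_of_dGHwt_lt {X Y : WtRealTree} {δ : ℝ} (hδ1 : δ ≤ 1) (h : dGHwt X Y < δ) :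
    GromovHausdorff.ghDist X.carrier Y.carrier ≤ 2 * δ := by
  obtain ⟨r, ⟨n, Z, h0, h1, rfl⟩, hr⟩ := exists_lt_of_csInf_lt (dGHwt_nonempty X Y) h
  have h2 := dist_le_fin_sum n (fun i => GromovHausdorff.toGHSpace (Z i).carrier)
  rw [h0, h1] at h2
  refine h2.trans (le_trans ?_ (mul_le_mul_of_nonneg_left hr.le (by norm_num)))
  rw [Finset.mul_sum]
  refine Finset.sum_le_sum fun i _ => (gh_le_delta _ _).trans ?_
  refine mul_le_mul_of_nonneg_left ?_ (by norm_num)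
  have h3 : Delta (Z i.castSucc) (Z i.succ) ^ ((1 : ℝ) / 4) ≤ 1 :=
    (Finset.single_le_sum (f := fun i : Fin n => Delta (Z i.castSucc) (Z i.succ) ^ ((1 : ℝ) / 4))
      (fun i _ => delta_rpow_nn _ _) (Finset.mem_univ i)).trans (hr.le.trans hδ1)
  have h4 : Delta (Z i.castSucc) (Z i.succ) ≤ 1 := by
    by_contra hgt
    push Not at hgt
    exact absurd (Real.one_lt_rpow hgt (by norm_num : (0 : ℝ) < 1 / 4)) (not_lt.2 h3)
  have := Real.rpow_le_rpow_of_exponent_ge' (delta_nn (Z i.castSucc) (Z i.succ)) h4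
    (by norm_num : (0 : ℝ) ≤ 1 / 4) (by norm_num : (1 / 4 : ℝ) ≤ 1)
  rwa [Real.rpow_one] at this

lemma delta_eq_zero_of_isometric {X Y : WtRealTree} (h : WPIsometric X Y) :
    Delta X Y = 0 ∧ Delta Y X = 0 := by
  obtain ⟨φ, hφ, hs, hm⟩ := h
  have key : ∀ δ : ℝ, 0 < δ → Delta X Y ≤ 5 * δ ∧ Delta Y X ≤ 5 * δ := fun δ hδ => by
    refine key_delta hφ.continuous.measurable hδ ⟨fun a b => ?_, fun y => ?_⟩ (fun C _ => ?_)
    · rw [hφ.dist_eq, sub_self, abs_zero]; exact hδ.le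
    · obtain ⟨x, rfl⟩ := hs y
      exact ⟨x, by simpa using hδ.le⟩
    · have : X.ν.map φ = Y.ν := hm
      rw [this]
      exact le_add_right (measure_mono (self_subset_thickening hδ C))
  constructor
  · refine le_antisymm (le_of_forall_pos_le_add fun ε hε => ?_) (delta_nn _ _)
    have := (key (ε / 5) (by linarith)).1
    linarith
  · refine le_antisymm (le_of_forall_pos_le_add fun ε hε => ?_) (delta_nn _ _)
    have := (key (ε / 5) (by linarith)).2
    linarith

lemma dGHwt_eqvGen {X Y : WtRealTree} (h : Relation.EqvGen WPIsometric X Y) :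
    ∀ W, dGHwt W X = dGHwt W Y := by
  induction h with
  | rel X Y h =>
    intro W
    obtain ⟨h1, h2⟩ := delta_eq_zero_of_isometric h
    have a := dGHwt_snoc W X Y
    have b := dGHwt_snoc W Y X
    rw [h1, Real.zero_rpow (by norm_num)] at a
    rw [h2, Real.zero_rpow (by norm_num)] at b
    linarith
  | refl => exact fun _ => rfl
  | symm _ _ _ ih => exact fun W => (ih W).symm
  | trans _ _ _ _ _ ih1 ih2 => exact fun W => (ih1 W).trans (ih2 W)

lemma dGHwt_out (W X : WtRealTree) : dGHwt W (Quot.out (Quot.mk WPIsometric X)) = dGHwt W X :=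
  dGHwt_eqvGen (Quot.eqvGen_exact (Quot.out_eq _)) W

end WtRealTree

section main

open Filter Topology

lemma wt_quarter {a ε : ℝ} (ha : 0 ≤ a) (hε : 0 < ε) (h : a < ε ^ 4) :
    a ^ ((1 : ℝ) / 4) < ε := by
  have h1 := Real.rpow_lt_rpow ha h (by norm_num : (0 : ℝ) < 1 / 4)
  have h2 : (ε ^ 4) ^ ((1 : ℝ) / 4) = ε := by
    have := Real.pow_rpow_inv_natCast hε.le (by norm_num : (4 : ℕ) ≠ 0)
    rw [one_div]
    exact_mod_cast this
  rwa [h2] at h1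

lemma exists_limit_measure {L : Type*} [MetricSpace L] [CompactSpace L] [MeasurableSpace L]
    [BorelSpace L] (μ : ℕ → Measure L) (hμ : ∀ n, IsProbabilityMeasure (μ n)) :
    ∃ ν : Measure L, IsProbabilityMeasure ν ∧ ∀ ε : ℝ, 0 < ε → ∀ N : ℕ,
      ∃ n ≥ N, PClose (μ n) ν ε := by
  let P : ℕ → ProbabilityMeasure L := fun n => ⟨μ n, hμ n⟩
  obtain ⟨ν, φ, hφ, hlim⟩ := CompactSpace.tendsto_subseq P
  refine ⟨ν, ν.2, fun ε hε N => ?_⟩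
  have h1 := ((LevyProkhorov.continuous_ofMeasure_probabilityMeasure (Ω := L)).tendsto ν).comp hlim
  have h2 := (EMetric.tendsto_nhds.1 h1) (ENNReal.ofReal ε) (by simpa using hε)
  obtain ⟨k, hk, hkN⟩ := (h2.and (eventually_ge_atTop N)).exists
  refine ⟨φ k, hkN.trans (hφ.id_le k), fun C hC => ?_⟩
  rw [LevyProkhorov.edist_probabilityMeasure_def] at hk
  have := left_measure_le_of_levyProkhorovEDist_lt hk hC.measurableSet
  rw [ENNReal.toReal_ofReal hε.le] at this
  exact this

lemma wt_complete (T : ℕ → WtRealTree)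
    (hT : ∀ ε : ℝ, 0 < ε → ∃ N : ℕ, ∀ m ≥ N, ∀ n ≥ N, dGHwt (T m) (T n) < ε) :
    ∃ L : WtRealTree, ∀ ε : ℝ, 0 < ε → ∃ N : ℕ, ∀ n ≥ N, dGHwt (T n) L < ε := by
  let G : ℕ → GromovHausdorff.GHSpace := fun n => GromovHausdorff.toGHSpace (T n).carrier
  have hG : CauchySeq G := by
    rw [Metric.cauchySeq_iff]
    intro ε hε
    obtain ⟨N, hN⟩ := hT (min 1 (ε / 3)) (by positivity)
    refine ⟨N, fun m hm n hn => ?_⟩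
    have h1 := WtRealTree.gh_le_of_dGHwt_lt (min_le_left _ _) (hN m hm n hn)
    have h2 := min_le_right 1 (ε / 3)
    have h3 : dist (G m) (G n) ≤ 2 * min 1 (ε / 3) := h1
    linarith
  obtain ⟨p, hp⟩ := cauchySeq_tendsto_of_complete hG
  have hdist : ∀ n, GromovHausdorff.ghDist (T n).carrier p.Rep = dist (G n) p := fun n => by
    rw [GromovHausdorff.ghDist, p.toGHSpace_rep]
  have htree : IsRealTree p.Rep := by
    refine limit_tree fun ε hε => ?_
    obtain ⟨N, hN⟩ := Metric.tendsto_atTop.1 hp (ε / 2) (by linarith)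
    have := hN N le_rfl
    rw [← hdist] at this
    obtain ⟨f, hf⟩ := gh_maps this
    exact ⟨T N, f, by convert hf using 1; ring⟩
  let _ : MeasurableSpace p.Rep := borel p.Rep
  have : BorelSpace p.Rep := ⟨rfl⟩
  have hex : ∀ n : ℕ, ∃ f : (T n).carrier → p.Rep, Measurable f ∧
      IsEpsIsometry f (5 * (dist (G n) p + 1 / ((n : ℝ) + 1))) := fun n => by
    have hpos : 0 < 1 / ((n : ℝ) + 1) := by positivity
    refine gh_maps_meas (add_pos_of_nonneg_of_pos dist_nonneg hpos) ?_
    rw [hdist]; linarith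
  choose f hfm hfi using hex
  obtain ⟨ν, hν, hcl⟩ := exists_limit_measure (fun n => (T n).ν.map (f n))
    (fun n => Measure.isProbabilityMeasure_map (hfm n).aemeasurable)
  refine ⟨⟨p.Rep, htree, ν, hν⟩, fun ε hε => ?_⟩
  obtain ⟨N, hN⟩ := hT (ε / 2) (by linarith)
  refine ⟨N, fun n hn => ?_⟩
  set η : ℝ := (ε / 2) ^ 4 / 6 with hη
  have hη0 : 0 < η := by positivity
  have hlim : Tendsto (fun n : ℕ => 5 * (dist (G n) p + 1 / ((n : ℝ) + 1))) atTop (𝓝 0) := by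
    have := ((tendsto_iff_dist_tendsto_zero.1 hp).add
      (tendsto_one_div_add_atTop_nhds_zero_nat (𝕜 := ℝ))).const_mul 5
    simpa using this
  obtain ⟨M, hM⟩ := eventually_atTop.1 (hlim.eventually (gt_mem_nhds hη0))
  obtain ⟨k, hk, hkc⟩ := hcl η hη0 (max N M)
  have hδ := hM k ((le_max_right _ _).trans hk)
  have hi : IsEpsIsometry (f k) η := ⟨fun x y => ((hfi k).1 x y).trans hδ.le,
    fun y => ((hfi k).2 y).imp fun x hx => hx.trans hδ.le⟩
  have hkey := (key_delta (hfm k) hη0 hi hkc).1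
  have hkey' : WtRealTree.Delta (T k) ⟨p.Rep, htree, ν, hν⟩ ≤ 5 * η := hkey
  have h1 := WtRealTree.dGHwt_snoc (T n) (T k) ⟨p.Rep, htree, ν, hν⟩
  have h2 := hN n hn k ((le_max_left _ _).trans hk)
  have h3 := wt_quarter (WtRealTree.delta_nn _ _) (by linarith : 0 < ε / 2)
    (hkey'.trans_lt (by rw [hη]; have : 0 < (ε / 2) ^ 4 := by positivity
                        linarith))
  linarith

/-- The discretized data of weighted trees at scale `δ`. -/
def wtData (δ : ℝ) (k : ℕ) : Set ((Fin k × Fin k → ℝ) × (Fin k → ℝ)) :=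
  {e | ∃ X : WtRealTree, ∃ (p : Fin k → X.carrier) (q : X.carrier → Fin k), Measurable q ∧
    (∀ x, dist x (p (q x)) ≤ δ) ∧ (∀ i j, e.1 (i, j) = dist (p i) (p j)) ∧
    ∀ i, e.2 i = X.ν.real (q ⁻¹' {i})}

lemma delta_of_data {X Y : WtRealTree} {δ : ℝ} (hδ : 0 < δ) {k : ℕ}
    {p : Fin k → X.carrier} {q : X.carrier → Fin k} (hq : Measurable q)
    (hpq : ∀ x, dist x (p (q x)) ≤ δ)
    {p' : Fin k → Y.carrier} {q' : Y.carrier → Fin k} (hq' : Measurable q')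
    (hpq' : ∀ x, dist x (p' (q' x)) ≤ δ)
    (hd : ∀ i j, |dist (p i) (p j) - dist (p' i) (p' j)| ≤ δ)
    (hw : ∀ i, |X.ν.real (q ⁻¹' {i}) - Y.ν.real (q' ⁻¹' {i})| ≤ δ / (k + 1)) :
    WtRealTree.Delta X Y ≤ 15 * δ := by
  classical
  have hfm : Measurable fun x => p' (q x) := (measurable_of_countable p').comp hq
  have hi : IsEpsIsometry (fun x => p' (q x)) (3 * δ) := by
    refine ⟨fun x y => ?_, fun y => ⟨p (q' y), ?_⟩⟩
    · have a := dist_triangle4 x (p (q x)) (p (q y)) y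
      have b := dist_triangle4 (p (q x)) x y (p (q y))
      rw [dist_comm (p (q y)) y] at a
      rw [dist_comm (p (q x)) x] at b
      have := hpq x
      have := hpq y
      have := abs_le.1 (hd (q x) (q y))
      rw [abs_le]
      constructor <;> linarith
    · have a := hpq' y
      have b := hpq (p (q' y))
      have c := abs_le.1 (hd (q' y) (q (p (q' y))))
      have d := dist_triangle y (p' (q' y)) (p' (q (p (q' y))))
      linarith
  have hp : PClose (X.ν.map fun x => p' (q x)) Y.ν (3 * δ) := by
    intro C hC
    rw [Measure.map_apply hfm hC.measurableSet]
    let S : Finset (Fin k) := Finset.univ.filter fun i => p' i ∈ C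
    have e1 : (fun x => p' (q x)) ⁻¹' C = q ⁻¹' (S : Set (Fin k)) := by
      ext x; simp [S]
    have s1 := sum_measureReal_preimage_singleton (μ := X.ν) S (f := q)
      (fun i _ => hq (measurableSet_singleton i))
    have s2 := sum_measureReal_preimage_singleton (μ := Y.ν) S (f := q')
      (fun i _ => hq' (measurableSet_singleton i))
    have hle : X.ν.real (q ⁻¹' (S : Set (Fin k))) ≤ Y.ν.real (q' ⁻¹' (S : Set (Fin k))) + δ := by
      rw [← s1, ← s2]
      calc ∑ i ∈ S, X.ν.real (q ⁻¹' {i})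
          ≤ ∑ i ∈ S, (Y.ν.real (q' ⁻¹' {i}) + δ / (k + 1)) :=
            Finset.sum_le_sum fun i _ => by have := abs_le.1 (hw i); linarith
        _ = ∑ i ∈ S, Y.ν.real (q' ⁻¹' {i}) + S.card * (δ / (k + 1)) := by
            rw [Finset.sum_add_distrib, Finset.sum_const, nsmul_eq_mul]
        _ ≤ _ := by
            have hc : (S.card : ℝ) ≤ k := by
              have := Finset.card_le_univ S
              rw [Fintype.card_fin] at this
              exact_mod_cast this
            have : (S.card : ℝ) * (δ / (k + 1)) ≤ δ := by
              rw [mul_div_assoc', div_le_iff₀ (by positivity)]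
              nlinarith
            linarith
    rw [e1]
    have hsub : q' ⁻¹' (S : Set (Fin k)) ⊆ thickening (3 * δ) C := by
      intro y hy
      have : p' (q' y) ∈ C := by simpa [S] using hy
      exact mem_thickening_iff.2 ⟨_, this, (hpq' y).trans_lt (by linarith)⟩
    calc X.ν (q ⁻¹' (S : Set (Fin k)))
        = ENNReal.ofReal (X.ν.real (q ⁻¹' (S : Set (Fin k)))) := by simp
      _ ≤ ENNReal.ofReal (Y.ν.real (q' ⁻¹' (S : Set (Fin k))) + δ) := ENNReal.ofReal_le_ofReal hle
      _ = Y.ν (q' ⁻¹' (S : Set (Fin k))) + ENNReal.ofReal δ := by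
          rw [ENNReal.ofReal_add measureReal_nonneg hδ.le]; simp
      _ ≤ _ := add_le_add (measure_mono hsub) (ENNReal.ofReal_le_ofReal (by linarith))
  have : WtRealTree.Delta X Y ≤ 5 * (3 * δ) := (key_delta hfm (by linarith) hi hp).1
  linarith

lemma wt_separable : ∃ D : Set Twt, D.Countable ∧
    ∀ x : Twt, ∀ ε : ℝ, 0 < ε → ∃ y ∈ D, distTwt x y < ε := by
  have hc : ∀ n k : ℕ, ∃ c : Set (wtData (1 / ((n : ℝ) + 1)) k), c.Countable ∧ Dense c :=
    fun n k => TopologicalSpace.exists_countable_dense _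
  choose c hcc hcd using hc
  let Ψ : ∀ n k : ℕ, wtData (1 / ((n : ℝ) + 1)) k → Twt :=
    fun n k e => Quot.mk _ (Classical.choose e.2)
  refine ⟨⋃ n, ⋃ k, Ψ n k '' c n k,
    countable_iUnion fun n => countable_iUnion fun k => (hcc n k).image _, fun x ε hε => ?_⟩
  obtain ⟨n, hn⟩ := exists_nat_one_div_lt (show 0 < ε ^ 4 / 15 by positivity)
  have hδ : 0 < 1 / ((n : ℝ) + 1) := by positivity
  obtain ⟨k, p, q, hq, hpq⟩ := wt_discretize (X := (Quot.out x : WtRealTree).carrier) hδ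
  let e : wtData (1 / ((n : ℝ) + 1)) k :=
    ⟨(fun ij => dist (p ij.1) (p ij.2), fun i => (Quot.out x : WtRealTree).ν.real (q ⁻¹' {i})),
      ⟨_, p, q, hq, hpq, fun _ _ => rfl, fun _ => rfl⟩⟩
  have hr : 0 < 1 / ((n : ℝ) + 1) / (k + 1) := by positivity
  obtain ⟨e', he', hee⟩ := (hcd n k).exists_dist_lt e hr
  refine ⟨Ψ n k e', mem_iUnion.2 ⟨n, mem_iUnion.2 ⟨k, mem_image_of_mem _ he'⟩⟩, ?_⟩
  obtain ⟨p', q', hq', hpq', h1, h2⟩ := Classical.choose_spec e'.2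
  have hE1 : ∀ ij, |e.1.1 ij - e'.1.1 ij| ≤ 1 / ((n : ℝ) + 1) / (k + 1) := fun ij => by
    rw [← Real.dist_eq]
    exact (dist_le_pi_dist _ _ ij).trans ((le_max_left _ _).trans hee.le)
  have hE2 : ∀ i, |e.1.2 i - e'.1.2 i| ≤ 1 / ((n : ℝ) + 1) / (k + 1) := fun i => by
    rw [← Real.dist_eq]
    exact (dist_le_pi_dist _ _ i).trans ((le_max_right _ _).trans hee.le)
  have hk : 1 / ((n : ℝ) + 1) / (k + 1) ≤ 1 / ((n : ℝ) + 1) :=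
    div_le_self hδ.le (by have : (0 : ℝ) ≤ k := Nat.cast_nonneg k
                          linarith)
  have hD := delta_of_data hδ hq hpq hq' hpq'
    (fun i j => by rw [← h1]; exact (hE1 (i, j)).trans hk) (fun i => by rw [← h2]; exact hE2 i)
  show dGHwt (Quot.out x) (Quot.out (Quot.mk WtRealTree.WPIsometric (Classical.choose e'.2))) < ε
  rw [WtRealTree.dGHwt_out]
  refine (WtRealTree.dGHwt_le _ _).trans_lt (wt_quarter (WtRealTree.delta_nn _ _) hε ?_)
  linarith

end main

/-- The metric space `(T^wt, d_GHwt)` is complete and separable: every `d_GHwt`-Cauchy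
sequence converges, and there is a countable `d_GHwt`-dense subset. -/
theorem twt_complete_and_separable :
    (∀ u : ℕ → Twt,
      (∀ ε : ℝ, 0 < ε → ∃ N : ℕ, ∀ m ≥ N, ∀ n ≥ N, distTwt (u m) (u n) < ε) →
      ∃ L : Twt, ∀ ε : ℝ, 0 < ε → ∃ N : ℕ, ∀ n ≥ N, distTwt (u n) L < ε) ∧
    (∃ D : Set Twt, D.Countable ∧ ∀ x : Twt, ∀ ε : ℝ, 0 < ε → ∃ y ∈ D, distTwt x y < ε) := by
  refine ⟨fun u hu => ?_, wt_separable⟩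
  obtain ⟨L, hL⟩ := wt_complete (fun n => (u n).out) hu
  refine ⟨Quot.mk _ L, fun ε hε => ?_⟩
  obtain ⟨N, hN⟩ := hL ε hε
  refine ⟨N, fun n hn => ?_⟩
  have := hN n hn
  rw [← WtRealTree.dGHwt_out] at this
  exact this
end

section
/- A subset D of (T^wt, d_GHwt) is relatively compact if and only if the subset E := {(T,d) : (T,d,ν) ∈ D} of (T, d_GH) obtained by forgetting the weights is relatively compact, where (T, d_GH) is the space of isometry classes of compact real trees with the Gromov–Hausdorff metric. -/
open Metric Set

/-- `(T, d_GH)`: the space of isometry classes of compact real trees, realized as the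
subspace of the Gromov–Hausdorff space consisting of classes of real trees, with the
Gromov–Hausdorff metric. -/
abbrev TreeSpace : Type := {p : GromovHausdorff.GHSpace // IsRealTree p.Rep}

/-- The isometry class of the compact real tree underlying a weighted compact real tree. -/
noncomputable def forgetWeight (a : Twt) : GromovHausdorff.GHSpace :=
  GromovHausdorff.toGHSpace a.out.carrier

section helpers
open MeasureTheory Filter Topology GromovHausdorff

lemma prohorovDist_le {X : Type*} [MetricSpace X] [MeasurableSpace X]
    {μ ν : Measure X} {ε : ℝ} (hε : 0 < ε)
    (h : ∀ C : Set X, IsClosed C → μ C ≤ ν (Metric.thickening ε C) + ENNReal.ofReal ε) :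
    prohorovDist μ ν ≤ ε :=
  csInf_le ⟨0, fun _ hx => hx.1.le⟩ ⟨hε, h⟩

lemma prohorovDist_le_one {X : Type*} [MetricSpace X] [MeasurableSpace X]
    {μ ν : Measure X} [IsProbabilityMeasure μ] : prohorovDist μ ν ≤ 1 :=
  prohorovDist_le one_pos fun C _ => by
    simpa using (prob_le_one (μ := μ) (s := C)).trans le_add_self

section generic
variable {X Y : Type*} [MetricSpace X] [MeasurableSpace X] [BorelSpace X]
  [MetricSpace Y] [MeasurableSpace Y] [BorelSpace Y]

lemma deltaGHwt_le {νX : Measure X} {νY : Measure Y} {ε : ℝ} (hε : 0 < ε)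
    {f : X → Y} (hf : Measurable f) (hf' : IsEpsIsometry f ε)
    (hfp : prohorovDist (νX.map f) νY ≤ ε)
    {g : Y → X} (hg : Measurable g) (hg' : IsEpsIsometry g ε)
    (hgp : prohorovDist νX (νY.map g) ≤ ε) : DeltaGHwt X Y νX νY ≤ ε :=
  csInf_le ⟨0, fun _ hx => hx.1.le⟩ ⟨hε, ⟨f, hf, hf', hfp⟩, ⟨g, hg, hg', hgp⟩⟩

lemma const_epsIsometry [CompactSpace X] [CompactSpace Y] (y : Y) [Nonempty X] :
    IsEpsIsometry (fun _ : X => y) (diam (univ : Set X) + diam (univ : Set Y) + 1) := by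
  have h1 : 0 ≤ diam (univ : Set X) := diam_nonneg
  have h2 : 0 ≤ diam (univ : Set Y) := diam_nonneg
  constructor
  · intro a b
    have := dist_le_diam_of_mem (isCompact_univ (X := X)).isBounded (mem_univ a) (mem_univ b)
    rw [dist_self, sub_zero, abs_of_nonneg dist_nonneg]
    linarith
  · intro z
    have := dist_le_diam_of_mem (isCompact_univ (X := Y)).isBounded (mem_univ z) (mem_univ y)
    exact ⟨Classical.arbitrary X, by linarith⟩

lemma ghDist_le_of_epsIsometry [CompactSpace X] [CompactSpace Y] [Nonempty X] [Nonempty Y]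
    {f : X → Y} {ε : ℝ} (hε : 0 < ε) (hf : IsEpsIsometry f ε) : ghDist X Y ≤ 2 * ε := by
  have := ghDist_le_of_approx_subsets (s := (univ : Set X)) (fun x => f x) (ε₁ := 0) (ε₂ := ε)
    (ε₃ := ε) (fun x => ⟨x, mem_univ _, by simp⟩)
    (fun y => by obtain ⟨x, hx⟩ := hf.2 y; exact ⟨⟨x, mem_univ _⟩, hx⟩)
    (fun x y => hf.1 x y)
  linarith

lemma ghDist_le_deltaGHwt [CompactSpace X] [CompactSpace Y] [Nonempty X] [Nonempty Y]
    (νX : Measure X) (νY : Measure Y) [IsProbabilityMeasure νX] [IsProbabilityMeasure νY] :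
    ghDist X Y ≤ 2 * DeltaGHwt X Y νX νY := by
  have h : ghDist X Y / 2 ≤ DeltaGHwt X Y νX νY := by
    apply le_csInf
    · have h1 : 0 ≤ diam (univ : Set X) := diam_nonneg
      have h2 : 0 ≤ diam (univ : Set Y) := diam_nonneg
      refine ⟨diam (univ : Set X) + diam (univ : Set Y) + 1, by linarith,
        ⟨fun _ => Classical.arbitrary Y, measurable_const, const_epsIsometry _, ?_⟩,
        ⟨fun _ => Classical.arbitrary X, measurable_const, ?_, ?_⟩⟩
      · have := Measure.isProbabilityMeasure_map (μ := νX)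
          (f := fun _ => Classical.arbitrary Y) aemeasurable_const
        exact prohorovDist_le_one.trans (by linarith)
      · rw [add_comm (diam (univ : Set X))]; exact const_epsIsometry _
      · exact prohorovDist_le_one.trans (by linarith)
    · rintro ε ⟨hε, ⟨f, -, hf, -⟩, -⟩
      have := ghDist_le_of_epsIsometry hε hf
      linarith
  linarith

lemma deltaGHwt_nonneg (νX : Measure X) (νY : Measure Y) : 0 ≤ DeltaGHwt X Y νX νY :=
  Real.sInf_nonneg fun _ hx => hx.1.le

lemma exists_near_map {Z : Type*} [MetricSpace Z] [Nonempty Y] [CompactSpace Y]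
    {Φ : X → Z} {Ψ : Y → Z} (hΦ : Isometry Φ) (hΨ : Isometry Ψ) {ε : ℝ}
    (h : ∀ x, ∃ y, dist (Φ x) (Ψ y) < ε) :
    ∃ f : X → Y, Measurable f ∧ ∀ x, dist (Φ x) (Ψ (f x)) < ε := by
  classical
  let p : X → ℕ → Prop := fun x k => dist (Φ x) (Ψ (TopologicalSpace.denseSeq Y k)) < ε
  have hp : ∀ x, ∃ k, p x k := by
    intro x
    obtain ⟨y, hy⟩ := h x
    have ho : IsOpen {y : Y | dist (Φ x) (Ψ y) < ε} :=
      isOpen_lt (continuous_const.dist hΨ.continuous) continuous_const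
    obtain ⟨k, hk⟩ := (TopologicalSpace.denseRange_denseSeq Y).exists_mem_open ho ⟨y, hy⟩
    exact ⟨k, hk⟩
  have hm : Measurable fun x => Nat.find (hp x) := by
    apply measurable_find hp
    intro k
    exact (isOpen_lt (hΦ.continuous.dist continuous_const) continuous_const).measurableSet
  exact ⟨fun x => TopologicalSpace.denseSeq Y (Nat.find (hp x)),
    (measurable_from_nat (f := TopologicalSpace.denseSeq Y)).comp hm,
    fun x => Nat.find_spec (hp x)⟩

lemma near_distortion {Z : Type*} [MetricSpace Z]
    {Φ : X → Z} {Ψ : Y → Z} (hΦ : Isometry Φ) (hΨ : Isometry Ψ) {ε : ℝ}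
    {f : X → Y} (h : ∀ x, dist (Φ x) (Ψ (f x)) < ε) : DistortionLE f (2 * ε) := by
  intro a b
  rw [← hΦ.dist_eq a b, ← hΨ.dist_eq (f a) (f b)]
  have h1 := h a
  have h2 := h b
  have h3 := dist_triangle4 (Φ a) (Ψ (f a)) (Ψ (f b)) (Φ b)
  have h4 := dist_triangle4 (Ψ (f a)) (Φ a) (Φ b) (Ψ (f b))
  rw [dist_comm (Ψ (f b)) (Φ b)] at h3
  rw [dist_comm (Ψ (f a)) (Φ a)] at h4
  rw [abs_le]
  constructor <;> linarith

lemma exists_maps [CompactSpace X] [CompactSpace Y] [Nonempty X] [Nonempty Y]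
    {ε : ℝ} (h : ghDist X Y < ε) :
    ∃ (f : X → Y) (g : Y → X), Measurable f ∧ Measurable g ∧ DistortionLE f (2 * ε) ∧
      DistortionLE g (2 * ε) ∧ (∀ x, dist x (g (f x)) ≤ 2 * ε) ∧
      ∀ y, dist y (f (g y)) ≤ 2 * ε := by
  have hΦ := isometry_optimalGHInjl X Y
  have hΨ := isometry_optimalGHInjr X Y
  rw [← hausdorffDist_optimal] at h
  have hfin : hausdorffEDist (range (optimalGHInjl X Y)) (range (optimalGHInjr X Y)) ≠ ⊤ :=
    hausdorffEDist_ne_top_of_nonempty_of_bounded (range_nonempty _) (range_nonempty _)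
      (isCompact_range hΦ.continuous).isBounded (isCompact_range hΨ.continuous).isBounded
  obtain ⟨f, hf, hf'⟩ := exists_near_map hΦ hΨ (ε := ε) (fun x => by
    obtain ⟨_, ⟨y, rfl⟩, hy⟩ := exists_dist_lt_of_hausdorffDist_lt (mem_range_self x) h hfin
    exact ⟨y, hy⟩)
  obtain ⟨g, hg, hg'⟩ := exists_near_map hΨ hΦ (ε := ε) (fun y => by
    obtain ⟨_, ⟨x, rfl⟩, hx⟩ := exists_dist_lt_of_hausdorffDist_lt' (mem_range_self y) h hfin
    exact ⟨x, by rwa [dist_comm]⟩)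
  refine ⟨f, g, hf, hg, near_distortion hΦ hΨ hf', near_distortion hΨ hΦ hg', ?_, ?_⟩
  · intro x
    rw [← hΦ.dist_eq]
    linarith [dist_triangle (optimalGHInjl X Y x) (optimalGHInjr X Y (f x))
      (optimalGHInjl X Y (g (f x))), hf' x, hg' (f x)]
  · intro y
    rw [← hΨ.dist_eq]
    linarith [dist_triangle (optimalGHInjr X Y y) (optimalGHInjl X Y (g y))
      (optimalGHInjr X Y (f (g y))), hg' y, hf' (g y)]

lemma deltaGHwt_le_of_maps {νX : Measure X} {νY : Measure Y} {ε : ℝ} (hε : 0 < ε)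
    {f : X → Y} {g : Y → X} (hf : Measurable f) (hg : Measurable g)
    (hf' : DistortionLE f (2 * ε)) (hg' : DistortionLE g (2 * ε))
    (hgf : ∀ x, dist x (g (f x)) ≤ 2 * ε) (hfg : ∀ y, dist y (f (g y)) ≤ 2 * ε)
    (hP : levyProkhorovEDist (νX.map f) νY < ENNReal.ofReal ε) :
    DeltaGHwt X Y νX νY ≤ 6 * ε := by
  have key : ∀ B : Set Y, MeasurableSet B →
      νX.map f B ≤ νY (thickening ε B) + ENNReal.ofReal ε := by
    intro B hB
    have := left_measure_le_of_levyProkhorovEDist_lt hP hB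
    rwa [ENNReal.toReal_ofReal hε.le] at this
  have hle : ENNReal.ofReal ε ≤ ENNReal.ofReal (6 * ε) :=
    ENNReal.ofReal_le_ofReal (by linarith)
  refine deltaGHwt_le (by linarith) hf ⟨fun a b => (hf' a b).trans (by linarith),
    fun y => ⟨g y, (hfg y).trans (by linarith)⟩⟩ ?_ hg
    ⟨fun a b => (hg' a b).trans (by linarith), fun x => ⟨f x, (hgf x).trans (by linarith)⟩⟩ ?_
  · refine prohorovDist_le (by linarith) fun C hC => (key C hC.measurableSet).trans ?_
    exact add_le_add (measure_mono (thickening_mono (by linarith) _)) hle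
  · refine prohorovDist_le (by linarith) fun C hC => ?_
    have h1 : νX C ≤ νX.map f (closure (f '' C)) := by
      rw [Measure.map_apply hf isClosed_closure.measurableSet]
      exact measure_mono fun x hx => subset_closure (mem_image_of_mem f hx)
    refine h1.trans ((key _ isClosed_closure.measurableSet).trans (add_le_add ?_ hle))
    rw [thickening_closure, Measure.map_apply hg isOpen_thickening.measurableSet]
    refine measure_mono fun y hy => ?_
    rw [mem_thickening_iff] at hy
    obtain ⟨_, ⟨c, hc, rfl⟩, hyc⟩ := hy
    rw [mem_preimage, mem_thickening_iff]
    refine ⟨c, hc, ?_⟩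
    have h2 := abs_le.1 (hg' y (f c))
    have h3 := hgf c
    have h4 := dist_triangle (g y) (g (f c)) c
    rw [dist_comm (g (f c)) c] at h4
    linarith [h2.1]

lemma prohorovDist_self_le (ν : Measure X) {ε : ℝ} (hε : 0 < ε) : prohorovDist ν ν ≤ ε :=
  prohorovDist_le hε fun C _ =>
    (measure_mono (self_subset_thickening hε C)).trans le_self_add

lemma isometryEquiv_eps (e : X ≃ᵢ Y) {ε : ℝ} (hε : 0 < ε) : IsEpsIsometry e ε :=
  ⟨fun a b => by simp [e.dist_eq, hε.le], fun y => ⟨e.symm y, by simp [hε.le]⟩⟩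

lemma deltaGHwt_eq_zero {νX : Measure X} {νY : Measure Y} (e : X ≃ᵢ Y)
    (h : νX.map e = νY) : DeltaGHwt X Y νX νY = 0 := by
  refine le_antisymm (le_of_forall_pos_le_add fun ε hε => ?_) (deltaGHwt_nonneg _ _)
  rw [zero_add]
  have hm : Measurable e := e.continuous.measurable
  have hm' : Measurable e.symm := e.symm.continuous.measurable
  refine deltaGHwt_le hε hm (isometryEquiv_eps e hε) ?_ hm' (isometryEquiv_eps e.symm hε) ?_
  · rw [h]; exact prohorovDist_self_le _ hε
  · rw [← h, Measure.map_map hm' hm]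
    have : (e.symm ∘ e : X → X) = id := by ext x; simp
    rw [this, Measure.map_id]; exact prohorovDist_self_le _ hε

end generic

lemma WtRealTree.Delta_nonneg (X Y : WtRealTree) : 0 ≤ X.Delta Y :=
  Real.sInf_nonneg fun _ hx => hx.1.le

lemma WtRealTree.ghDist_le_Delta (X Y : WtRealTree) :
    ghDist X.carrier Y.carrier ≤ 2 * X.Delta Y := by
  letI : MeasurableSpace X.carrier := borel X.carrier
  letI : MeasurableSpace Y.carrier := borel Y.carrier
  haveI : BorelSpace X.carrier := ⟨rfl⟩
  haveI : BorelSpace Y.carrier := ⟨rfl⟩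
  haveI := X.prob
  haveI := Y.prob
  exact ghDist_le_deltaGHwt X.ν Y.ν

lemma WtRealTree.WPIsometric.exists_equiv {X Y : WtRealTree} (h : X.WPIsometric Y) :
    ∃ e : X.carrier ≃ᵢ Y.carrier,
      @Measure.map _ _ (borel X.carrier) (borel Y.carrier) e X.ν = Y.ν := by
  obtain ⟨φ, h1, h2, h3⟩ := h
  exact ⟨⟨Equiv.ofBijective φ ⟨h1.injective, h2⟩, h1⟩, h3⟩

lemma WtRealTree.WPIsometric.Delta_eq_zero {X Y : WtRealTree} (h : X.WPIsometric Y) :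
    X.Delta Y = 0 := by
  letI : MeasurableSpace X.carrier := borel X.carrier
  letI : MeasurableSpace Y.carrier := borel Y.carrier
  haveI : BorelSpace X.carrier := ⟨rfl⟩
  haveI : BorelSpace Y.carrier := ⟨rfl⟩
  obtain ⟨e, he⟩ := h.exists_equiv
  exact deltaGHwt_eq_zero e he

lemma wpIsometric_equivalence : Equivalence WtRealTree.WPIsometric where
  refl X := by
    letI : MeasurableSpace X.carrier := borel X.carrier
    exact ⟨id, isometry_id, Function.surjective_id, Measure.map_id⟩
  symm := by
    intro X Y h
    letI : MeasurableSpace X.carrier := borel X.carrier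
    letI : MeasurableSpace Y.carrier := borel Y.carrier
    haveI : BorelSpace X.carrier := ⟨rfl⟩
    haveI : BorelSpace Y.carrier := ⟨rfl⟩
    obtain ⟨e, he⟩ := h.exists_equiv
    refine ⟨e.symm, e.symm.isometry, e.symm.surjective, ?_⟩
    have hm : Measurable e := e.continuous.measurable
    have hm' : Measurable e.symm := e.symm.continuous.measurable
    rw [← he, Measure.map_map hm' hm]
    have : (e.symm ∘ e : X.carrier → X.carrier) = id := by ext x; simp
    rw [this, Measure.map_id]
  trans := by
    rintro X Y Z ⟨φ, h1, h2, h3⟩ ⟨ψ, k1, k2, k3⟩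
    letI : MeasurableSpace X.carrier := borel X.carrier
    letI : MeasurableSpace Y.carrier := borel Y.carrier
    letI : MeasurableSpace Z.carrier := borel Z.carrier
    haveI : BorelSpace X.carrier := ⟨rfl⟩
    haveI : BorelSpace Y.carrier := ⟨rfl⟩
    haveI : BorelSpace Z.carrier := ⟨rfl⟩
    refine ⟨ψ ∘ φ, k1.comp h1, k2.comp h2, ?_⟩
    rw [← Measure.map_map k1.continuous.measurable h1.continuous.measurable, h3, k3]

lemma wpIsometric_out (X : WtRealTree) :
    X.WPIsometric (Quot.out (Quot.mk WtRealTree.WPIsometric X)) := by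
  have h : Quot.mk WtRealTree.WPIsometric (Quot.out (Quot.mk WtRealTree.WPIsometric X)) =
    Quot.mk WtRealTree.WPIsometric X := Quot.out_eq _
  exact wpIsometric_equivalence.symm (wpIsometric_equivalence.quot_mk_eq_iff _ _ |>.1 h)

lemma chain_ghDist (n : ℕ) (Z : Fin (n + 1) → WtRealTree) :
    dist (toGHSpace (Z 0).carrier) (toGHSpace (Z (Fin.last n)).carrier) ≤
      2 * ∑ i : Fin n, (Z i.castSucc).Delta (Z i.succ) := by
  induction n with
  | zero => simp
  | succ n ih =>
    have h1 := ih (fun i => Z i.castSucc)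
    have h2 := WtRealTree.ghDist_le_Delta (Z (Fin.last n).castSucc) (Z (Fin.last n).succ)
    have h3 := dist_triangle (toGHSpace (Z 0).carrier)
      (toGHSpace (Z (Fin.last n).castSucc).carrier) (toGHSpace (Z (Fin.last n).succ).carrier)
    rw [Fin.sum_univ_castSucc]
    rw [ghDist] at h2
    simp only [Fin.castSucc_zero, Fin.succ_castSucc] at *
    simp only [Fin.succ_last] at *
    linarith

lemma dGHwt_nonneg (X Y : WtRealTree) : 0 ≤ dGHwt X Y := by
  apply Real.sInf_nonneg
  rintro r ⟨n, Z, -, -, rfl⟩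
  exact Finset.sum_nonneg fun i _ => Real.rpow_nonneg (WtRealTree.Delta_nonneg _ _) _

lemma dGHwt_bddBelow (X Y : WtRealTree) :
    BddBelow {r : ℝ | ∃ (n : ℕ) (Z : Fin (n + 1) → WtRealTree), Z 0 = X ∧ Z (Fin.last n) = Y ∧
    r = ∑ i : Fin n, (WtRealTree.Delta (Z i.castSucc) (Z i.succ)) ^ ((1 : ℝ) / 4)} := by
  refine ⟨0, ?_⟩
  rintro r ⟨n, Z, -, -, rfl⟩
  exact Finset.sum_nonneg fun i _ => Real.rpow_nonneg (WtRealTree.Delta_nonneg _ _) _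

lemma dGHwt_le_two (X Y Y' : WtRealTree) :
    dGHwt X Y' ≤ X.Delta Y ^ ((1 : ℝ) / 4) + Y.Delta Y' ^ ((1 : ℝ) / 4) := by
  refine csInf_le (dGHwt_bddBelow X Y') ⟨2, ![X, Y, Y'], rfl, rfl, ?_⟩
  rw [Fin.sum_univ_two]
  rfl

lemma ghDist_lt_of_dGHwt_lt {X Y : WtRealTree} {r : ℝ} (hr : r ≤ 1) (h : dGHwt X Y < r) :
    dist (toGHSpace X.carrier) (toGHSpace Y.carrier) < 2 * r := by
  have hne : {r : ℝ | ∃ (n : ℕ) (Z : Fin (n + 1) → WtRealTree), Z 0 = X ∧ Z (Fin.last n) = Y ∧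
    r = ∑ i : Fin n, (WtRealTree.Delta (Z i.castSucc) (Z i.succ)) ^ ((1 : ℝ) / 4)}.Nonempty :=
    ⟨_, 1, ![X, Y], rfl, rfl, rfl⟩
  obtain ⟨s, ⟨n, Z, rfl, rfl, rfl⟩, hs⟩ := exists_lt_of_csInf_lt hne h
  refine (chain_ghDist n Z).trans_lt ?_
  have hle : ∑ i : Fin n, (Z i.castSucc).Delta (Z i.succ) ≤
      ∑ i : Fin n, (WtRealTree.Delta (Z i.castSucc) (Z i.succ)) ^ ((1 : ℝ) / 4) := by
    refine Finset.sum_le_sum fun i _ => ?_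
    have h0 := WtRealTree.Delta_nonneg (Z i.castSucc) (Z i.succ)
    have h1 : (WtRealTree.Delta (Z i.castSucc) (Z i.succ)) ^ ((1 : ℝ) / 4) ≤ 1 := by
      refine le_trans ?_ (hs.le.trans hr)
      exact Finset.single_le_sum
        (f := fun i : Fin n => (WtRealTree.Delta (Z i.castSucc) (Z i.succ)) ^ ((1 : ℝ) / 4))
        (fun i _ => Real.rpow_nonneg (WtRealTree.Delta_nonneg _ _) _) (Finset.mem_univ i)
    have h2 : WtRealTree.Delta (Z i.castSucc) (Z i.succ) ≤ 1 := by
      by_contra hc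
      push Not at hc
      exact absurd h1 (not_le.2 (Real.one_lt_rpow hc (by norm_num)))
    calc _ = WtRealTree.Delta (Z i.castSucc) (Z i.succ) ^ (1 : ℝ) := (Real.rpow_one _).symm
      _ ≤ _ := Real.rpow_le_rpow_of_exponent_ge' h0 h2 (by norm_num) (by norm_num)
  linarith

lemma IsRealTree.of_isometryEquiv {X Y : Type*} [MetricSpace X] [MetricSpace Y]
    (h : IsRealTree X) (e : X ≃ᵢ Y) : IsRealTree Y := by
  obtain ⟨h1, h2, h3⟩ := h
  refine ⟨e.completeSpace_iff.1 h1, e.surjective.pathConnectedSpace e.continuous, ?_⟩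
  intro a b c d
  have := h3 (e.symm a) (e.symm b) (e.symm c) (e.symm d)
  simpa only [e.symm.dist_eq] using this

lemma isRealTree_rep (X : WtRealTree) : IsRealTree (toGHSpace X.carrier).Rep := by
  obtain ⟨e⟩ := toGHSpace_eq_toGHSpace_iff_isometryEquiv.1 (toGHSpace X.carrier).toGHSpace_rep
  exact X.tree.of_isometryEquiv e.symm

lemma isCompact_closure_of_seq {M : Type*} [MetricSpace M] {E : Set M}
    (h : ∀ u : ℕ → M, (∀ n, u n ∈ E) → ∃ φ : ℕ → ℕ, StrictMono φ ∧ ∃ a,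
      Tendsto (u ∘ φ) atTop (𝓝 a)) : IsCompact (closure E) := by
  rw [isCompact_iff_isSeqCompact]
  intro v hv
  have : ∀ n : ℕ, ∃ x ∈ E, dist (v n) x < 1 / ((n : ℝ) + 1) := fun n =>
    Metric.mem_closure_iff.1 (hv n) _ (by positivity)
  choose u huE hu using this
  obtain ⟨φ, hφ, a, ha⟩ := h u huE
  have hd : Tendsto (fun n => dist (v (φ n)) (u (φ n))) atTop (𝓝 0) :=
    squeeze_zero (fun _ => dist_nonneg) (fun n => (hu (φ n)).le)
      ((tendsto_one_div_add_atTop_nhds_zero_nat (𝕜 := ℝ)).comp hφ.tendsto_atTop)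
  have hva : Tendsto (v ∘ φ) atTop (𝓝 a) := by
    rw [tendsto_iff_dist_tendsto_zero] at ha ⊢
    refine squeeze_zero (fun _ => dist_nonneg) (fun n => dist_triangle _ (u (φ n)) _) ?_
    simpa using hd.add ha
  exact ⟨a, isClosed_closure.mem_of_tendsto hva (Eventually.of_forall fun n => hv _), φ, hφ, hva⟩

lemma twt_forward (D : Set Twt) (h : ∀ u : ℕ → Twt, (∀ n, u n ∈ D) →
      ∃ φ : ℕ → ℕ, StrictMono φ ∧ ∃ L : Twt,
        Filter.Tendsto (fun n => distTwt (u (φ n)) L) Filter.atTop (nhds 0)) :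
    IsCompact (closure {p : TreeSpace | ∃ a ∈ D, (p : GHSpace) = forgetWeight a}) := by
  apply isCompact_closure_of_seq
  intro p hp
  choose u huD hu using hp
  obtain ⟨φ, hφ, L, hL⟩ := h u huD
  refine ⟨φ, hφ, ⟨forgetWeight L, isRealTree_rep _⟩, ?_⟩
  rw [Metric.tendsto_atTop]
  intro ε hε
  have hpos : 0 < min 1 (ε / 2) := by positivity
  obtain ⟨N, hN⟩ := eventually_atTop.1 (hL.eventually (gt_mem_nhds hpos))
  refine ⟨N, fun n hn => ?_⟩
  have := ghDist_lt_of_dGHwt_lt (min_le_left _ _) (hN n hn)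
  rw [Subtype.dist_eq, Function.comp_apply, hu]
  refine this.trans_le ?_
  linarith [min_le_right 1 (ε / 2)]

/-- Convergence of the underlying trees gives a subsequence of weighted trees which converges. -/
lemma exists_limit (X : ℕ → WtRealTree) (p : TreeSpace)
    (hX : Tendsto (fun n => dist (toGHSpace (X n).carrier) (p : GHSpace)) atTop (𝓝 0)) :
    ∃ φ : ℕ → ℕ, StrictMono φ ∧ ∃ L : WtRealTree,
      Tendsto (fun n => (X (φ n)).Delta L) atTop (𝓝 0) := by
  let Y : Type := (p : GHSpace).Rep
  letI : ∀ n, MeasurableSpace (X n).carrier := fun n => borel (X n).carrier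
  haveI : ∀ n, BorelSpace (X n).carrier := fun n => ⟨rfl⟩
  haveI : ∀ n, IsProbabilityMeasure (X n).ν := fun n => (X n).prob
  letI : MeasurableSpace Y := borel Y
  haveI : BorelSpace Y := ⟨rfl⟩
  let ε : ℕ → ℝ := fun n => ghDist (X n).carrier Y + 1 / ((n : ℝ) + 1)
  have hε : Tendsto ε atTop (𝓝 0) := by
    have h1 : Tendsto (fun n => ghDist (X n).carrier Y) atTop (𝓝 0) := by
      refine hX.congr fun n => ?_
      rw [ghDist]
      congr 1
      exact (p : GHSpace).toGHSpace_rep.symm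
    simpa [ε] using h1.add (tendsto_one_div_add_atTop_nhds_zero_nat (𝕜 := ℝ))
  have hlt : ∀ n, ghDist (X n).carrier Y < ε n := fun n => by
    have : (0 : ℝ) < 1 / ((n : ℝ) + 1) := by positivity
    simp only [ε]; linarith
  choose f g hf hg hf' hg' hgf hfg using fun n => exists_maps (hlt n)
  let P : ℕ → ProbabilityMeasure Y := fun n =>
    ⟨(X n).ν.map (f n), Measure.isProbabilityMeasure_map (hf n).aemeasurable⟩
  obtain ⟨Q, ψ, hψ, hQ⟩ := CompactSpace.tendsto_subseq P
  refine ⟨ψ, hψ, ⟨Y, p.2, (Q : Measure Y), Q.2⟩, ?_⟩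
  have hLP : Tendsto (fun n => levyProkhorovEDist ((X (ψ n)).ν.map (f (ψ n))) (Q : Measure Y))
      atTop (𝓝 0) := by
    have := ((LevyProkhorov.continuous_ofMeasure_probabilityMeasure (Ω := Y)).tendsto Q).comp hQ
    rw [tendsto_iff_edist_tendsto_0] at this
    exact this
  rw [Metric.tendsto_atTop]
  intro η hη
  have hη' : 0 < η / 12 := by positivity
  have e1 := hLP.eventually (gt_mem_nhds (ENNReal.ofReal_pos.2 hη'))
  have e2 := (hε.comp hψ.tendsto_atTop).eventually (gt_mem_nhds hη')
  obtain ⟨N, hN⟩ := eventually_atTop.1 (e1.and e2)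
  refine ⟨N, fun n hn => ?_⟩
  obtain ⟨a1, a2⟩ := hN n hn
  simp only [Function.comp_apply] at a2
  have := deltaGHwt_le_of_maps hη' (hf (ψ n)) (hg (ψ n))
    (fun a b => (hf' (ψ n) a b).trans (by linarith))
    (fun a b => (hg' (ψ n) a b).trans (by linarith))
    (fun a => (hgf (ψ n) a).trans (by linarith))
    (fun a => (hfg (ψ n) a).trans (by linarith)) a1
  rw [Real.dist_eq, sub_zero, abs_of_nonneg (WtRealTree.Delta_nonneg _ _)]
  exact this.trans_lt (by linarith)

lemma twt_backward (D : Set Twt)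
    (h : IsCompact (closure {p : TreeSpace | ∃ a ∈ D, (p : GHSpace) = forgetWeight a}))
    (u : ℕ → Twt) (hu : ∀ n, u n ∈ D) :
      ∃ φ : ℕ → ℕ, StrictMono φ ∧ ∃ L : Twt,
        Filter.Tendsto (fun n => distTwt (u (φ n)) L) Filter.atTop (nhds 0) := by
  let q : ℕ → TreeSpace := fun n => ⟨forgetWeight (u n), isRealTree_rep _⟩
  obtain ⟨p, -, φ, hφ, hp⟩ := h.tendsto_subseq (x := q)
    (fun n => subset_closure ⟨u n, hu n, rfl⟩)
  rw [tendsto_iff_dist_tendsto_zero] at hp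
  obtain ⟨ψ, hψ, L, hL⟩ := exists_limit (fun n => (u (φ n)).out) p hp
  refine ⟨φ ∘ ψ, hφ.comp hψ, Quot.mk _ L, ?_⟩
  have h4 : Tendsto (fun n => ((u (φ (ψ n))).out.Delta L) ^ ((1 : ℝ) / 4)) atTop (𝓝 0) := by
    have := hL.rpow_const (p := (1 : ℝ) / 4) (Or.inr (by norm_num))
    rwa [Real.zero_rpow (by norm_num)] at this
  refine squeeze_zero (fun n => dGHwt_nonneg _ _) (fun n => ?_) h4
  have := dGHwt_le_two (u (φ (ψ n))).out L (Quot.out (Quot.mk WtRealTree.WPIsometric L))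
  rw [(wpIsometric_out L).Delta_eq_zero, Real.zero_rpow (by norm_num), add_zero] at this
  exact this

end helpers

/-- A subset `D` of `(T^wt, d_GHwt)` is relatively compact (every sequence in `D` has a
subsequence converging in `T^wt`) if and only if the set `E = {(T,d) : (T,d,ν) ∈ D}` of
underlying trees is relatively compact in `(T, d_GH)`. -/
theorem twt_relatively_compact_iff (D : Set Twt) :
    (∀ u : ℕ → Twt, (∀ n, u n ∈ D) →
      ∃ φ : ℕ → ℕ, StrictMono φ ∧ ∃ L : Twt,
        Filter.Tendsto (fun n => distTwt (u (φ n)) L) Filter.atTop (nhds 0)) ↔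
    IsCompact (closure {p : TreeSpace | ∃ a ∈ D, (p : GromovHausdorff.GHSpace) = forgetWeight a}) := by
  exact ⟨twt_forward D, twt_backward D⟩
end

section
/- For n ∈ ℕ, define the truncated averaged distance d̄_n(T,d,ν) := ∫_T ∫_T (d(x,y) ∧ n) ν(dx) ν(dy) on weighted compact real trees. Then for all weighted compact real trees (T,d_T,ν_T) and (S,d_S,ν_S), |d̄_n(T,d_T,ν_T) − d̄_n(S,d_S,ν_S)| ≤ (3 + 2n) · Δ_GHwt((T,d_T,ν_T), (S,d_S,ν_S)); moreover sup d̄_n ≤ n. -/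
open Metric Set

/-- The truncated `ν`-averaged distance `d̄_n = ∫∫ (d(x,y) ∧ n) ν(dx) ν(dy)`. -/
noncomputable def avgDistTrunc (n : ℕ) (X : Type*) [MetricSpace X] [MeasurableSpace X]
    (ν : MeasureTheory.Measure X) : ℝ :=
  ∫ x, ∫ y, min (dist x y) (n : ℝ) ∂ν ∂ν

section Aux
open MeasureTheory

lemma aux_one_sided {X : Type*} [MetricSpace X] [CompactSpace X] [MeasurableSpace X] [BorelSpace X]
    (μ ν : Measure X) [IsProbabilityMeasure μ] [IsProbabilityMeasure ν] (n : ℕ) (h : X → ℝ)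
    (hl : ∀ x y, |h x - h y| ≤ dist x y) (hc : Continuous h)
    (h0 : ∀ x, 0 ≤ h x) (hn : ∀ x, h x ≤ n) (ε : ℝ) (hε : 0 < ε)
    (hP : ∀ C : Set X, IsClosed C → μ C ≤ ν (Metric.thickening ε C) + ENNReal.ofReal ε) :
    ∫ x, h x ∂μ ≤ ∫ x, h x ∂ν + (1 + n) * ε := by
  have hint : ∀ (ρ : Measure X) [IsProbabilityMeasure ρ], Integrable h ρ := fun ρ _ =>
    Integrable.of_bound hc.aestronglyMeasurable n
      (Filter.Eventually.of_forall fun x => by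
        rw [Real.norm_eq_abs, abs_of_nonneg (h0 x)]; exact hn x)
  have key : ∫⁻ x, ENNReal.ofReal (h x) ∂μ ≤
      ∫⁻ x, ENNReal.ofReal (h x + ε) ∂ν + ENNReal.ofReal (ε * n) := by
    rw [lintegral_eq_lintegral_meas_le μ (Filter.Eventually.of_forall h0) hc.aemeasurable,
      lintegral_eq_lintegral_meas_le ν
        (Filter.Eventually.of_forall fun x => (add_nonneg (h0 x) hε.le))
        (by fun_prop)]
    have hb : ∀ t ∈ Set.Ioi (0:ℝ), μ {a | t ≤ h a} ≤ ν {a | t ≤ h a + ε} +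
        (Set.Ioc (0:ℝ) n).indicator (fun _ => ENNReal.ofReal ε) t := by
      intro t ht
      by_cases htn : t ≤ n
      · have hmem : t ∈ Set.Ioc (0:ℝ) n := ⟨ht, htn⟩
        rw [Set.indicator_of_mem hmem]
        refine (hP _ (isClosed_le continuous_const hc)).trans ?_
        gcongr
        intro x hx
        obtain ⟨z, hz, hxz⟩ := Metric.mem_thickening_iff.1 hx
        have := (abs_le.1 (hl x z)).1
        simp only [Set.mem_setOf_eq] at hz ⊢
        linarith
      · have : {a | t ≤ h a} = ∅ := by
          ext x
          simp only [Set.mem_setOf_eq, Set.mem_empty_iff_false, iff_false]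
          intro hx
          exact htn (hx.trans (hn x))
        simp [this]
    refine (setLIntegral_mono' measurableSet_Ioi hb).trans ?_
    rw [lintegral_add_right _ (measurable_const.indicator measurableSet_Ioc)]
    gcongr
    refine (setLIntegral_le_lintegral _ _).trans ?_
    rw [lintegral_indicator measurableSet_Ioc, setLIntegral_const, Real.volume_Ioc, sub_zero,
      ENNReal.ofReal_mul hε.le]
  have hi2 : Integrable (fun x => h x + ε) ν := (hint ν).add (integrable_const ε)
  rw [← ofReal_integral_eq_lintegral_ofReal (hint μ) (Filter.Eventually.of_forall h0),
    ← ofReal_integral_eq_lintegral_ofReal hi2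
      (Filter.Eventually.of_forall fun x => (add_nonneg (h0 x) hε.le)),
    ← ENNReal.ofReal_add (integral_nonneg fun x => (add_nonneg (h0 x) hε.le)) (by positivity),
    ENNReal.ofReal_le_ofReal_iff (add_nonneg (integral_nonneg fun x => (add_nonneg (h0 x) hε.le))
      (by positivity)), integral_add (hint ν) (integrable_const ε)] at key
  simp at key
  linarith

lemma aux_lip {X : Type*} [MetricSpace X] {h : X → ℝ}
    (hl : ∀ x y, |h x - h y| ≤ dist x y) : Continuous h :=
  (LipschitzWith.of_dist_le_mul (K := 1) fun x y => by
    simpa [Real.dist_eq] using hl x y).continuous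

lemma aux_int {X : Type*} [MetricSpace X] [CompactSpace X] [MeasurableSpace X] [BorelSpace X]
    (n : ℕ) (h : X → ℝ) (hc : Continuous h)
    (h0 : ∀ x, 0 ≤ h x) (hn : ∀ x, h x ≤ n) (ρ : Measure X) [IsProbabilityMeasure ρ] :
    Integrable h ρ :=
  Integrable.of_bound hc.aestronglyMeasurable n
      (Filter.Eventually.of_forall fun x => by
        rw [Real.norm_eq_abs, abs_of_nonneg (h0 x)]; exact hn x)

lemma aux_two_sided {X : Type*} [MetricSpace X] [CompactSpace X] [MeasurableSpace X] [BorelSpace X]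
    (μ ν : Measure X) [IsProbabilityMeasure μ] [IsProbabilityMeasure ν] (n : ℕ) (h : X → ℝ)
    (hl : ∀ x y, |h x - h y| ≤ dist x y)
    (h0 : ∀ x, 0 ≤ h x) (hn : ∀ x, h x ≤ n) :
    |∫ x, h x ∂μ - ∫ x, h x ∂ν| ≤ prohorovDist μ ν * (1 + n) := by
  have hc := aux_lip hl
  rw [← div_le_iff₀ (by positivity)]
  refine le_csInf ⟨1, one_pos, fun C _ => ?_⟩ ?_
  · simpa using (prob_le_one (μ := μ) (s := C)).trans le_add_self
  rintro ε ⟨hε, hP⟩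
  rw [div_le_iff₀ (by positivity), abs_le]
  have h1 := aux_one_sided μ ν n h hl hc h0 hn ε hε hP
  have h2 := aux_one_sided μ ν n (fun x => n - h x)
    (fun x y => by
      have := hl y x
      rw [dist_comm] at this
      convert this using 2
      ring)
    (by fun_prop) (fun x => by linarith [hn x]) (fun x => by linarith [h0 x]) ε hε hP
  rw [integral_sub (integrable_const _) (aux_int n h hc h0 hn μ),
    integral_sub (integrable_const _) (aux_int n h hc h0 hn ν)] at h2
  simp at h2
  constructor <;> linarith

lemma aux_k (a b c : ℝ) : |min a c - min b c| ≤ |a - b| := by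
  simpa using abs_min_sub_min_le_max a c b c

lemma aux_G_lip {X : Type*} [MetricSpace X] [CompactSpace X] [MeasurableSpace X] [BorelSpace X]
    (ν : Measure X) [IsProbabilityMeasure ν] (n : ℕ) (x x' : X) :
    |∫ y, min (dist x y) (n : ℝ) ∂ν - ∫ y, min (dist x' y) (n : ℝ) ∂ν| ≤ dist x x' := by
  have hi : ∀ z : X, Integrable (fun y => min (dist z y) (n : ℝ)) ν := fun z =>
    aux_int n _ (by fun_prop) (fun _ => by positivity) (fun _ => min_le_right _ _) ν
  rw [← integral_sub (hi x) (hi x')]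
  have := norm_integral_le_of_norm_le_const (μ := ν) (C := dist x x')
    (f := fun y => min (dist x y) (n : ℝ) - min (dist x' y) (n : ℝ))
    (Filter.Eventually.of_forall fun y =>
      (aux_k _ _ _).trans (abs_dist_sub_le x x' y))
  simpa using this

lemma aux_G_le {X : Type*} [MetricSpace X] [CompactSpace X] [MeasurableSpace X] [BorelSpace X]
    (ν : Measure X) [IsProbabilityMeasure ν] (n : ℕ) (x : X) :
    ∫ y, min (dist x y) (n : ℝ) ∂ν ≤ n := by
  have := integral_mono (μ := ν) (aux_int n (fun y => min (dist x y) (n : ℝ)) (by fun_prop)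
    (fun _ => by positivity) (fun _ => min_le_right _ _) ν) (integrable_const (n : ℝ))
    (fun _ => min_le_right _ _)
  simpa using this

lemma aux_G_int {X : Type*} [MetricSpace X] [CompactSpace X] [MeasurableSpace X] [BorelSpace X]
    (ν ρ : Measure X) [IsProbabilityMeasure ν] [IsProbabilityMeasure ρ] (n : ℕ) :
    Integrable (fun x => ∫ y, min (dist x y) (n : ℝ) ∂ν) ρ :=
  aux_int n _ (aux_lip (aux_G_lip ν n)) (fun _ => integral_nonneg fun _ => by positivity)
    (aux_G_le ν n) ρ

lemma aux_prob {X : Type*} [MetricSpace X] [CompactSpace X] [MeasurableSpace X] [BorelSpace X]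
    (μ ν : Measure X) [IsProbabilityMeasure μ] [IsProbabilityMeasure ν] (n : ℕ) :
    |avgDistTrunc n X μ - avgDistTrunc n X ν| ≤ 2 * (prohorovDist μ ν * (1 + n)) := by
  unfold avgDistTrunc
  have h1 := aux_two_sided μ ν n _ (aux_G_lip ν n)
    (fun _ => integral_nonneg fun _ => by positivity) (aux_G_le ν n)
  have h2 : |∫ x, ∫ y, min (dist x y) (n : ℝ) ∂μ ∂μ - ∫ x, ∫ y, min (dist x y) (n : ℝ) ∂ν ∂μ|
      ≤ prohorovDist μ ν * (1 + n) := by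
    rw [← integral_sub (aux_G_int μ μ n) (aux_G_int ν μ n)]
    have := norm_integral_le_of_norm_le_const (μ := μ) (C := prohorovDist μ ν * (1 + n))
      (f := fun x => ∫ y, min (dist x y) (n : ℝ) ∂μ - ∫ y, min (dist x y) (n : ℝ) ∂ν)
      (Filter.Eventually.of_forall fun x =>
        aux_two_sided μ ν n (fun y => min (dist x y) (n : ℝ))
          (fun y z => (aux_k _ _ _).trans (by
            rw [dist_comm x y, dist_comm x z]; exact abs_dist_sub_le y z x))
          (fun _ => by positivity) (fun _ => min_le_right _ _))
    simpa using this
  refine (abs_sub_le _ _ _).trans ((add_le_add h2 h1).trans (by linarith))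

lemma aux_map {X Y : Type*} [MetricSpace X] [CompactSpace X] [MeasurableSpace X] [BorelSpace X]
    [MetricSpace Y] [CompactSpace Y] [MeasurableSpace Y] [BorelSpace Y]
    (μ : Measure X) [IsProbabilityMeasure μ] (n : ℕ) (f : X → Y) (hf : Measurable f) (ε : ℝ)
    (hd : DistortionLE f ε) :
    |avgDistTrunc n X μ - avgDistTrunc n Y (μ.map f)| ≤ ε := by
  have : IsProbabilityMeasure (μ.map f) := Measure.isProbabilityMeasure_map hf.aemeasurable
  unfold avgDistTrunc
  have hi : ∀ z : X, Integrable (fun y => min (dist z y) (n : ℝ)) μ := fun z =>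
    aux_int n _ (by fun_prop) (fun _ => by positivity) (fun _ => min_le_right _ _) μ
  have hi' : ∀ z : Y, Integrable (fun y => min (dist z y) (n : ℝ)) (μ.map f) := fun z =>
    aux_int n _ (by fun_prop) (fun _ => by positivity) (fun _ => min_le_right _ _) _
  have hG := aux_G_int (μ.map f) (μ.map f) n
  have hG2 : Integrable (fun x => ∫ y, min (dist (f x) y) (n : ℝ) ∂(μ.map f)) μ :=
    hG.comp_measurable hf
  rw [integral_map hf.aemeasurable hG.aestronglyMeasurable,
    ← integral_sub (aux_G_int μ μ n) hG2]
  have := norm_integral_le_of_norm_le_const (μ := μ) (C := ε)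
      (f := fun x => ∫ y, min (dist x y) (n : ℝ) ∂μ - ∫ y, min (dist (f x) y) (n : ℝ) ∂(μ.map f))
      (Filter.Eventually.of_forall fun x => by
        have hi2 : Integrable (fun y => min (dist (f x) (f y)) (n : ℝ)) μ :=
          (hi' (f x)).comp_measurable hf
        rw [integral_map hf.aemeasurable (hi' (f x)).aestronglyMeasurable,
          ← integral_sub (hi x) hi2]
        have := norm_integral_le_of_norm_le_const (μ := μ) (C := ε)
          (f := fun y => min (dist x y) (n : ℝ) - min (dist (f x) (f y)) (n : ℝ))
          (Filter.Eventually.of_forall fun y => (aux_k _ _ _).trans (hd x y))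
        simpa using this)
  simpa using this

lemma aux_const {X Y : Type*} [MetricSpace X] [CompactSpace X]
    [MetricSpace Y] [CompactSpace Y] [Nonempty X] (y : Y) (ε : ℝ)
    (h1 : Metric.diam (Set.univ : Set X) ≤ ε) (h2 : Metric.diam (Set.univ : Set Y) ≤ ε) :
    IsEpsIsometry (fun _ : X => y) ε := by
  refine ⟨fun a b => ?_, fun z => ⟨Classical.arbitrary X, ?_⟩⟩
  · simpa using (Metric.dist_le_diam_of_mem isCompact_univ.isBounded
      (Set.mem_univ a) (Set.mem_univ b)).trans h1
  · exact (Metric.dist_le_diam_of_mem isCompact_univ.isBounded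
      (Set.mem_univ z) (Set.mem_univ y)).trans h2

lemma aux_proh_le {X : Type*} [MetricSpace X] [MeasurableSpace X]
    (μ ν : Measure X) [IsProbabilityMeasure μ] : prohorovDist μ ν ≤ 1 :=
  csInf_le ⟨0, fun _ h => h.1.le⟩ ⟨one_pos, fun C _ => by
    simpa using (prob_le_one (μ := μ) (s := C)).trans le_add_self⟩

end Aux

/-- The truncated averaged distance `d̄_n` is bounded by `n` and is Lipschitz with
constant `3 + 2n` with respect to `Δ_GHwt` on weighted compact real trees. -/
theorem avgDistTrunc_lipschitz (n : ℕ)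
    (X Y : Type*) [MetricSpace X] [CompactSpace X] [Nonempty X]
    [MeasurableSpace X] [BorelSpace X]
    [MetricSpace Y] [CompactSpace Y] [Nonempty Y]
    [MeasurableSpace Y] [BorelSpace Y]
    (hX : IsRealTree X) (hY : IsRealTree Y)
    (νX : MeasureTheory.Measure X) (νY : MeasureTheory.Measure Y)
    [MeasureTheory.IsProbabilityMeasure νX] [MeasureTheory.IsProbabilityMeasure νY] :
    |avgDistTrunc n X νX - avgDistTrunc n Y νY| ≤
      (3 + 2 * (n : ℝ)) * DeltaGHwt X Y νX νY ∧
    avgDistTrunc n X νX ≤ (n : ℝ) := by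
  constructor
  · rw [mul_comm, ← div_le_iff₀ (by positivity)]
    refine le_csInf ?_ ?_
    · have d1 := Metric.diam_nonneg (s := (Set.univ : Set X))
      have d2 := Metric.diam_nonneg (s := (Set.univ : Set Y))
      have : MeasureTheory.IsProbabilityMeasure
          (νX.map (fun _ : X => Classical.arbitrary Y)) :=
        MeasureTheory.Measure.isProbabilityMeasure_map measurable_const.aemeasurable
      refine ⟨Metric.diam (Set.univ : Set X) + Metric.diam (Set.univ : Set Y) + 1,
        by linarith, ⟨fun _ => Classical.arbitrary Y, measurable_const,
          aux_const _ _ (by linarith) (by linarith), ?_⟩,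
        ⟨fun _ => Classical.arbitrary X, measurable_const,
          aux_const _ _ (by linarith) (by linarith), ?_⟩⟩
      · exact (aux_proh_le _ _).trans (by linarith)
      · exact (aux_proh_le _ _).trans (by linarith)
    · rintro ε ⟨hε, ⟨f, hf, hiso, hp⟩, -⟩
      rw [div_le_iff₀ (by positivity)]
      have : MeasureTheory.IsProbabilityMeasure (νX.map f) :=
        MeasureTheory.Measure.isProbabilityMeasure_map hf.aemeasurable
      have h1 := aux_map νX n f hf ε hiso.1
      have h2 := aux_prob (νX.map f) νY n
      have h3 : prohorovDist (νX.map f) νY * (1 + n) ≤ ε * (1 + n) := by gcongr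
      refine (abs_sub_le _ _ _).trans ((add_le_add h1 h2).trans (by linarith))
  · have := MeasureTheory.integral_mono (aux_G_int νX νX n)
      (MeasureTheory.integrable_const (n : ℝ)) (aux_G_le νX n)
    simpa [avgDistTrunc] using this
end
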